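/- arXiv:2211.13678 — 3 statements merged into one kernel-verified Lean document; each statement's English description precedes it below -/
import Mathlib

section
/- Let G be a finite abelian group of order n, where n has a prime divisor congruent to 2 mod 3 and p is the smallest such prime. Then χ(G,3) = (1 + 1/p)·(n/3) + 1, where χ(G,3) is the least m such that every subset of size at least m has 3-fold sumset equal to G. -/
open Finset Pointwise

/-- `C` is a union of cosets of a subgroup `H` with `N ≤ |C| + |H|`. -/
def IsPeriodicOfLargeCard {G : Type*} [AddCommGroup G] (N : ℕ) (C : Finset G) : Prop :=
  ∃ H : AddSubgroup G, (∀ h ∈ H, ∀ x, x + h ∈ C ↔ x ∈ C) ∧ N ≤ C.card + Nat.card H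

open scoped Classical in
theorem AddSubgroup.natCard_eq_card_filter_mem {G : Type*} [AddCommGroup G] [Fintype G]
    (H : AddSubgroup G) : Nat.card H = (univ.filter (· ∈ H)).card := by
  rw [Nat.card_eq_fintype_card, Fintype.card_subtype]

section Kneser

variable {G : Type*} [AddCommGroup G] [Fintype G] [DecidableEq G]

open scoped Classical in
theorem card_mul_card_le_card_inf_mul (H₁ H₂ : AddSubgroup G) (c : G) (Y X S : Finset G)
    (hY : ∀ y ∈ Y, y ∈ H₁) (hX : ∀ x ∈ X, x ∈ H₂) (hS : ∀ y ∈ Y, ∀ x ∈ X, c + y + x ∈ S) :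
    Y.card * X.card ≤ Nat.card (H₁ ⊓ H₂ : AddSubgroup G) * S.card := by
  rw [← card_product]
  have hf : Set.MapsTo (fun q : G × G => c + q.1 + q.2) ↑(Y ×ˢ X) (S : Set G) := by
    intro q hq
    have := mem_product.1 (mem_coe.1 hq)
    exact hS _ this.1 _ this.2
  rw [card_eq_sum_card_fiberwise hf, mul_comm, ← smul_eq_mul]
  refine sum_le_card_nsmul _ _ _ fun s _ => ?_
  rcases ((Y ×ˢ X).filter fun q => c + q.1 + q.2 = s).eq_empty_or_nonempty with h | ⟨q₀, hq₀⟩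
  · simp [h]
  simp only [mem_filter, mem_product] at hq₀
  obtain ⟨⟨hy₀, hx₀⟩, he₀⟩ := hq₀
  rw [AddSubgroup.natCard_eq_card_filter_mem]
  refine card_le_card_of_injOn (fun q => q.1 - q₀.1) ?_ ?_
  · intro q hq
    simp only [coe_filter, mem_product, Set.mem_ofPred_eq] at hq
    obtain ⟨⟨hy, hx⟩, he⟩ := hq
    simp only [coe_filter, mem_univ, true_and, Set.mem_ofPred_eq, AddSubgroup.mem_inf]
    refine ⟨H₁.sub_mem (hY _ hy) (hY _ hy₀), ?_⟩
    have : q.1 - q₀.1 = q₀.2 - q.2 := by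
      have h := he.trans he₀.symm
      rw [sub_eq_sub_iff_add_eq_add]
      rw [add_assoc, add_assoc] at h
      rw [add_left_cancel h, add_comm]
    rw [this]
    exact H₂.sub_mem (hX _ hx₀) (hX _ hx)
  · intro q hq r hr h
    simp only [coe_filter, mem_product, Set.mem_ofPred_eq] at hq hr
    have h₁ : q.1 = r.1 := sub_left_injective h
    have h₂ := hq.2.trans hr.2.symm
    rw [h₁] at h₂
    exact Prod.ext h₁ (add_left_cancel h₂)

open scoped Classical in
/-- A coset of `H₁ + H₂` meeting `C₂ \ C₁`, when both set differences are small, avoids `C₁`. -/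
theorem card_le_card_sdiff_of_small {C₁ C₂ : Finset G} {H₁ H₂ : AddSubgroup G}
    (h₁ : ∀ h ∈ H₁, ∀ x, x + h ∈ C₁ ↔ x ∈ C₁) (h₂ : ∀ h ∈ H₂, ∀ x, x + h ∈ C₂ ↔ x ∈ C₂)
    {c : G} (hc₂ : c ∈ C₂) (hc₁ : c ∉ C₁)
    (hs₂ : (C₂ \ C₁).card + Nat.card (H₁ ⊓ H₂ : AddSubgroup G) < Nat.card H₁)
    (hs₁ : (C₁ \ C₂).card + Nat.card (H₁ ⊓ H₂ : AddSubgroup G) < Nat.card H₂) :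
    Nat.card H₂ ≤ (C₂ \ C₁).card := by
  set m := Nat.card (H₁ ⊓ H₂ : AddSubgroup G)
  have hmpos : 0 < m := Nat.card_pos
  let F₁ : Finset G := univ.filter (· ∈ H₁)
  let F₂ : Finset G := univ.filter (· ∈ H₂)
  let K : Finset G := univ.filter (· ∈ H₁ ⊓ H₂)
  have hF₁ : F₁.card = Nat.card H₁ := H₁.natCard_eq_card_filter_mem.symm
  have hF₂ : F₂.card = Nat.card H₂ := H₂.natCard_eq_card_filter_mem.symm
  have hK : K.card = m := (H₁ ⊓ H₂).natCard_eq_card_filter_mem.symm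
  let X := F₂.filter fun x => c + x ∉ C₁
  let X' := F₂.filter fun x => ¬ c + x ∉ C₁
  let Y := F₁.filter fun y => c + y ∈ C₂
  let Y' := F₁.filter fun y => ¬ c + y ∈ C₂
  have hX : X.card + X'.card = Nat.card H₂ := by
    rw [← hF₂]; exact card_filter_add_card_filter_not _
  have hY : Y.card + Y'.card = Nat.card H₁ := by
    rw [← hF₁]; exact card_filter_add_card_filter_not _
  have hKX : m ≤ X.card := by
    rw [← hK]
    refine card_le_card fun k hk => ?_
    simp only [K, X, F₂, mem_filter, mem_univ, true_and, AddSubgroup.mem_inf] at hk ⊢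
    exact ⟨hk.2, by rwa [h₁ k hk.1]⟩
  have hKY : m ≤ Y.card := by
    rw [← hK]
    refine card_le_card fun k hk => ?_
    simp only [K, Y, F₁, mem_filter, mem_univ, true_and, AddSubgroup.mem_inf] at hk ⊢
    exact ⟨hk.1, by rwa [h₂ k hk.2]⟩
  have hYX : Y.card * X.card ≤ m * (C₂ \ C₁).card := by
    refine card_mul_card_le_card_inf_mul H₁ H₂ c Y X _ (by simp [Y, F₁]; tauto)
      (by simp [X, F₂]; tauto) fun y hy x hx => ?_
    simp only [Y, X, F₁, F₂, mem_filter, mem_univ, true_and] at hy hx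
    rw [mem_sdiff, h₂ x hx.1, add_right_comm, h₁ y hy.1]
    exact ⟨hy.2, hx.2⟩
  have hYX' : Y'.card * X'.card ≤ m * (C₁ \ C₂).card := by
    refine card_mul_card_le_card_inf_mul H₁ H₂ c Y' X' _ (by simp [Y', F₁]; tauto)
      (by simp [X', F₂]; tauto) fun y hy x hx => ?_
    simp only [Y', X', F₁, F₂, mem_filter, mem_univ, true_and, not_not] at hy hx
    rw [mem_sdiff, h₂ x hx.1, add_right_comm, h₁ y hy.1]
    exact ⟨hx.2, hy.2⟩
  rcases X'.eq_empty_or_nonempty with h | ⟨x₀, hx₀⟩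
  · rw [h, card_empty, add_zero] at hX
    rw [← hX]
    exact Nat.le_of_mul_le_mul_left ((Nat.mul_le_mul_right _ hKY).trans hYX) hmpos
  exfalso
  have hKX' : m ≤ X'.card := by
    rw [← hK]
    refine card_le_card_of_injOn (fun k => x₀ + k) (fun k hk => ?_)
      fun _ _ _ _ h => add_left_cancel h
    simp only [K, X', F₂, coe_filter, mem_filter, mem_univ, true_and, AddSubgroup.mem_inf,
      Set.mem_ofPred_eq, not_not] at hk hx₀ ⊢
    exact ⟨H₂.add_mem hx₀.1 hk.2, by rw [← add_assoc, h₁ k hk.1]; exact hx₀.2⟩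
  rw [← hY] at hs₂
  rw [← hX] at hs₁
  obtain ⟨s, hs⟩ := Nat.exists_eq_add_of_le hKX
  obtain ⟨t, ht⟩ := Nat.exists_eq_add_of_le hKX'
  obtain ⟨r, hr⟩ := Nat.exists_eq_add_of_le hKY
  rw [hs, hr] at hYX
  rw [ht] at hYX'
  rw [hr] at hs₂
  rw [hs, ht] at hs₁
  have hm₂ : m * (C₂ \ C₁).card < m * (r + Y'.card) :=
    Nat.mul_lt_mul_of_pos_left (by omega) hmpos
  have hm₁ : m * (C₁ \ C₂).card < m * (s + m + t) :=
    Nat.mul_lt_mul_of_pos_left (by omega) hmpos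
  have hsq : m * (m + s) < m * Y'.card := by nlinarith [Nat.zero_le (r * s)]
  have hsq' : m + s < Y'.card := Nat.lt_of_mul_lt_mul_left hsq
  nlinarith [Nat.mul_le_mul_right (m + t) hsq'.le, Nat.zero_le (s * t)]

theorem IsPeriodicOfLargeCard.union {N : ℕ} {C₁ C₂ : Finset G}
    (hC₁ : IsPeriodicOfLargeCard N C₁) (hC₂ : IsPeriodicOfLargeCard N C₂) :
    IsPeriodicOfLargeCard N (C₁ ∪ C₂) := by
  by_cases h₂₁ : C₂ ⊆ C₁
  · rwa [union_eq_left.2 h₂₁]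
  by_cases h₁₂ : C₁ ⊆ C₂
  · rwa [union_eq_right.2 h₁₂]
  obtain ⟨H₁, h₁, hN₁⟩ := hC₁
  obtain ⟨H₂, h₂, hN₂⟩ := hC₂
  refine ⟨H₁ ⊓ H₂, fun h hh x => ?_, ?_⟩
  · rw [mem_union, mem_union, h₁ h hh.1, h₂ h hh.2]
  by_contra! hlt
  have e₁ : (C₁ ∪ C₂).card = C₁.card + (C₂ \ C₁).card := by
    rw [← card_union_of_disjoint disjoint_sdiff, union_sdiff_self_eq_union]
  have e₂ : (C₁ ∪ C₂).card = C₂.card + (C₁ \ C₂).card := by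
    rw [← card_union_of_disjoint disjoint_sdiff, union_sdiff_self_eq_union, union_comm]
  have hs₂ : (C₂ \ C₁).card + Nat.card (H₁ ⊓ H₂ : AddSubgroup G) < Nat.card H₁ := by omega
  have hs₁ : (C₁ \ C₂).card + Nat.card (H₁ ⊓ H₂ : AddSubgroup G) < Nat.card H₂ := by omega
  obtain ⟨c, hc₂, hc₁⟩ := not_subset.1 h₂₁
  obtain ⟨d, hd₁, hd₂⟩ := not_subset.1 h₁₂
  have := card_le_card_sdiff_of_small h₁ h₂ hc₂ hc₁ hs₂ hs₁
  rw [inf_comm] at hs₁ hs₂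
  have := card_le_card_sdiff_of_small h₂ h₁ hd₁ hd₂ hs₁ hs₂
  omega

/-- The iterated Dyson transform. -/
theorem exists_isPeriodicOfLargeCard_subset_add (k : ℕ) :
    ∀ {A B : Finset G} {a b : G}, B.card ≤ k → a ∈ A → b ∈ B →
      ∃ C ⊆ A + B, a + b ∈ C ∧ IsPeriodicOfLargeCard (A.card + B.card) C := by
  classical
  induction k with
  | zero =>
    intro A B a b hk _ hb
    exact absurd hb (by simp [card_eq_zero.1 (Nat.le_zero.1 hk)])
  | succ k ih =>
    intro A B a b hk ha hb
    by_cases hAB : ∀ e ∈ A, ∀ x ∈ B, x + (e - b) ∈ A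
    · refine ⟨A.image (· + b), ?_, mem_image_of_mem _ ha, ?_⟩
      · intro z hz
        obtain ⟨y, hy, rfl⟩ := mem_image.1 hz
        exact add_mem_add hy hb
      let H : AddSubgroup G := AddAction.stabilizer G (A : Set G)
      have hH : ∀ {h : G}, h ∈ H → ∀ x, x + h ∈ A ↔ x ∈ A := by
        intro h hh x
        have : h +ᵥ (A : Set G) = A := hh
        rw [← mem_coe, ← mem_coe, add_comm, ← vadd_eq_add]
        nth_rewrite 1 [← this]
        exact Set.vadd_mem_vadd_set_iff
      refine ⟨H, fun h hh x => ?_, ?_⟩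
      · simp only [mem_image]
        constructor
        · rintro ⟨y, hy, hyx⟩
          refine ⟨x - b, (hH hh _).1 ?_, by abel⟩
          rwa [show x - b + h = y by rw [sub_add_eq_add_sub, ← hyx, add_sub_cancel_right]]
        · rintro ⟨y, hy, rfl⟩
          exact ⟨y + h, (hH hh _).2 hy, by abel⟩
      · rw [card_image_of_injective _ (add_left_injective b)]
        refine Nat.add_le_add_left ?_ _
        rw [AddSubgroup.natCard_eq_card_filter_mem]
        refine card_le_card_of_injOn (fun x => x - b) (fun x hx => ?_)
          fun _ _ _ _ h => sub_left_injective h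
        simp only [coe_filter, mem_univ, true_and, Set.mem_ofPred_eq]
        change (x - b) +ᵥ (A : Set G) = A
        have : (x - b) +ᵥ A = A := by
          refine eq_of_subset_of_card_le ?_ (by simp)
          intro z hz
          obtain ⟨e, he, rfl⟩ := mem_vadd_finset.1 hz
          have := hAB e he x hx
          rwa [vadd_eq_add, sub_add_eq_add_sub, add_sub_assoc]
        exact_mod_cast congrArg (fun s : Finset G => (s : Set G)) this
    · push Not at hAB
      obtain ⟨e, he, x, hx, hxe⟩ := hAB
      let T := B.image (· + (e - b))
      let B' := B.filter fun y => y + (e - b) ∈ A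
      have hT : T.card = B.card := card_image_of_injective _ (add_left_injective _)
      have hB' : B'.card = (A ∩ T).card := by
        rw [← card_image_of_injective B' (add_left_injective (e - b))]
        congr 1
        ext z
        simp only [B', T, mem_image, mem_filter, mem_inter]
        constructor
        · rintro ⟨y, hy, rfl⟩
          exact ⟨hy.2, y, hy.1, rfl⟩
        · rintro ⟨hz, y, hy, rfl⟩
          exact ⟨y, ⟨hy, hz⟩, rfl⟩
      have hlt : B'.card < B.card :=
        card_lt_card (filter_ssubset.2 ⟨x, hx, hxe⟩)
      have hb' : b ∈ B' := by simp [B', hb, he]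
      obtain ⟨C, hC, hab, hP⟩ := ih (A := A ∪ T) (B := B') (by omega) (mem_union_left _ ha) hb'
      refine ⟨C, hC.trans ?_, hab, ?_⟩
      · intro z hz
        obtain ⟨u, hu, v, hv, rfl⟩ := mem_add.1 hz
        simp only [B', mem_filter] at hv
        rcases mem_union.1 hu with hu | hu
        · exact add_mem_add hu hv.1
        · obtain ⟨y, hy, rfl⟩ := mem_image.1 hu
          rw [show y + (e - b) + v = (v + (e - b)) + y by abel]
          exact add_mem_add hv.2 hy
      · have : (A ∪ T).card + B'.card = A.card + B.card := by
          rw [hB', card_union_add_card_inter, hT]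
        rwa [this] at hP

/-- The **Kneser addition theorem**, in its weak form. -/
theorem isPeriodicOfLargeCard_add {A B : Finset G} (hA : A.Nonempty) (hB : B.Nonempty) :
    IsPeriodicOfLargeCard (A.card + B.card) (A + B) := by
  have key : ∀ c ∈ A + B, ∃ C ⊆ A + B, c ∈ C ∧ IsPeriodicOfLargeCard (A.card + B.card) C := by
    intro c hc
    obtain ⟨a, ha, b, hb, rfl⟩ := mem_add.1 hc
    exact exists_isPeriodicOfLargeCard_subset_add B.card le_rfl ha hb
  choose! f hf hcf hP using key
  have hne : (A + B).Nonempty := hA.add hB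
  have : A + B = (A + B).sup' hne f := by
    refine le_antisymm (fun c hc => ?_) (sup'_le _ _ hf)
    exact (le_sup' f hc : f c ≤ _) (hcf c hc)
  rw [this]
  exact sup'_induction hne f (p := IsPeriodicOfLargeCard (A.card + B.card))
    (fun _ h₁ _ h₂ => h₁.union h₂) hP

end Kneser

theorem Nat.exists_prime_dvd_mod_three_eq_two {d : ℕ} (hd : d % 3 = 2) :
    ∃ q : ℕ, q.Prime ∧ q ∣ d ∧ q % 3 = 2 := by
  induction d using Nat.strong_induction_on with
  | _ d ih =>
    obtain ⟨q, hq, e, rfl⟩ := Nat.exists_prime_and_dvd (show d ≠ 1 by omega)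
    by_cases hq2 : q % 3 = 2
    · exact ⟨q, hq, dvd_mul_right _ _, hq2⟩
    have he : e % 3 = 2 := by
      have : q % 3 < 3 := Nat.mod_lt _ (by norm_num)
      have : e % 3 < 3 := Nat.mod_lt _ (by norm_num)
      rw [Nat.mul_mod] at hd
      generalize q % 3 = u at *
      generalize e % 3 = v at *
      interval_cases u <;> interval_cases v <;> simp_all
    have hpos : 0 < e := by omega
    obtain ⟨r, hr, hre, hr2⟩ := ih e (by nlinarith [hq.two_le]) he
    exact ⟨r, hr, hre.mul_left _, hr2⟩

theorem Module.exists_surjective_addMonoidHom (K : Type*) {V : Type*} [Field K] [AddCommGroup V]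
    [Module K V] {x : V} (hx : x ≠ 0) : ∃ f : V →+ K, Function.Surjective f := by
  obtain ⟨φ, hφ⟩ : ∃ φ : Module.Dual K V, φ x ≠ 0 := by
    by_contra! h
    exact hx ((Module.forall_dual_apply_eq_zero_iff K x).1 h)
  exact ⟨φ.toAddMonoidHom, LinearMap.surjective (f := φ) fun h => hφ (by simp [h])⟩

theorem exists_surjective_addMonoidHom_zmod_of_nsmul_eq_zero {Q : Type*} [AddCommGroup Q] (p : ℕ)
    [Fact p.Prime] (hQ : ∀ y : Q, p • y = 0) {x : Q} (hx : x ≠ 0) :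
    ∃ f : Q →+ ZMod p, Function.Surjective f :=
  @Module.exists_surjective_addMonoidHom (ZMod p) Q _ _ (AddCommGroup.zmodModule hQ) x hx

theorem exists_surjective_addMonoidHom_zmod {G : Type*} [AddCommGroup G] [Fintype G] (p : ℕ) [Fact p.Prime]
    (hpn : p ∣ Fintype.card G) :
    ∃ f : G →+ ZMod p, Function.Surjective f := by
  let M : AddSubgroup G := (nsmulAddMonoidHom (α := G) p).range
  have hM : ∃ x, x ∉ M := by
    by_contra! h
    have hsurj : Function.Surjective (nsmulAddMonoidHom (α := G) p) := fun x => h x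
    obtain ⟨x, hx⟩ := exists_prime_addOrderOf_dvd_card p hpn
    have hx0 : x = 0 := Finite.injective_iff_surjective.2 hsurj (by
      simp [← hx, addOrderOf_nsmul_eq_zero])
    rw [hx0, addOrderOf_zero] at hx
    exact (Fact.out : p.Prime).one_lt.ne hx
  obtain ⟨x, hx⟩ := hM
  have hp0 : ∀ y : G ⧸ M, p • y = 0 := by
    intro y
    induction y using QuotientAddGroup.induction_on with
    | H z => exact (QuotientAddGroup.eq_zero_iff _).2 ⟨z, rfl⟩
  obtain ⟨f, hf⟩ := exists_surjective_addMonoidHom_zmod_of_nsmul_eq_zero p hp0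
    (x := (x : G ⧸ M)) fun h => hx ((QuotientAddGroup.eq_zero_iff x).1 h)
  exact ⟨f.comp (QuotientAddGroup.mk' M), hf.comp (QuotientAddGroup.mk'_surjective M)⟩

section Sumset

variable {G : Type*} [AddCommGroup G] [Fintype G] [DecidableEq G]

theorem exists_addSubgroup_three_mul_le (A : Finset G) (hA : A + A + A ≠ univ) :
    ∃ (H : AddSubgroup G) (a : ℕ), A.card ≤ a * Nat.card H ∧
      3 * (a * Nat.card H) ≤ Fintype.card G + Nat.card H := by
  classical
  rcases A.eq_empty_or_nonempty with rfl | hne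
  · exact ⟨⊥, 0, by simp, by simp⟩
  let P : AddSubgroup G → Prop := fun H => A + A + A + univ.filter (· ∈ H) ≠ univ
  have hP : ∃ H, P H := ⟨⊥, by
    simpa [P, filter_eq', show ({0} : Finset G) = 0 from rfl] using hA⟩
  obtain ⟨H, hH⟩ := exists_maximal_of_wellFoundedGT P hP
  let F : Finset G := univ.filter (· ∈ H)
  have hF : ∀ x, x ∈ F ↔ x ∈ H := by simp [F]
  have hFF : F + F = F := by
    ext x
    rw [mem_add]
    constructor
    · rintro ⟨y, hy, z, hz, rfl⟩
      rw [hF] at *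
      exact H.add_mem hy hz
    · exact fun hx => ⟨x, hx, 0, (hF 0).2 H.zero_mem, add_zero x⟩
  have hAF : A ⊆ A + F := fun x hx => mem_add.2 ⟨x, hx, 0, (hF 0).2 H.zero_mem, add_zero x⟩
  have hsum : A + F + (A + F) + (A + F) = A + A + A + F := by
    calc A + F + (A + F) + (A + F) = A + A + A + (F + F + F) := by abel
      _ = _ := by rw [hFF, hFF]
  obtain ⟨K, hK, hcard⟩ := isPeriodicOfLargeCard_add (hne.mono hAF) (hne.mono hAF)
  obtain ⟨g, hg⟩ : ∃ g, g ∉ A + A + A + F := by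
    by_contra! h
    exact hH.prop (eq_univ_iff_forall.2 h)
  have hle : (A + F + (A + F)).card + (A + F).card ≤ Fintype.card G := by
    rw [← card_image_of_injective (A + F) (sub_right_injective (b := g)),
      ← card_union_of_disjoint]
    · exact card_le_univ _
    · rw [disjoint_right]
      intro x hx hx'
      obtain ⟨y, hy, rfl⟩ := mem_image.1 hx
      exact hg (hsum ▸ mem_add.2 ⟨_, hx', y, hy, sub_add_cancel g y⟩)
  have hKH : K ≤ H := by
    refine le_sup_right.trans (hH.le_of_ge (y := H ⊔ K) ?_ le_sup_left)
    intro huniv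
    have hgm : g ∈ A + A + A + univ.filter (· ∈ H ⊔ K) := by
      rw [huniv]; exact mem_univ g
    obtain ⟨s, hs, l, hl, rfl⟩ := mem_add.1 hgm
    obtain ⟨h, hh, k, hk, rfl⟩ := AddSubgroup.mem_sup.1 (mem_filter.1 hl).2
    have hsh : s + h ∈ A + F + (A + F) + (A + F) := by
      rw [hsum]; exact add_mem_add hs ((hF h).2 hh)
    obtain ⟨u, hu, v, hv, huv⟩ := mem_add.1 hsh
    apply hg
    rw [← hsum, show s + (h + k) = u + k + v by rw [← add_assoc, ← huv, add_right_comm]]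
    exact add_mem_add ((hK k hk u).2 hu) hv
  have hKc : Nat.card K ≤ Nat.card H := AddSubgroup.card_le_of_le hKH
  have hcoset : (A + F).card
      = Nat.card (Set.image (QuotientAddGroup.mk : G → G ⧸ H) (A : Set G)) * Nat.card H := by
    rw [mul_comm, ← AddSubgroup.card_add_eq_card_addSubgroup_add_card_quotient,
      ← Nat.card_eq_finsetCard]
    have : (A : Set G) + (H : Set G) = ((A + F : Finset G) : Set G) := by
      rw [coe_add]
      congr 1
      ext x
      simp [F]
    rw [this]
    rfl
  refine ⟨H, Nat.card (Set.image (QuotientAddGroup.mk : G → G ⧸ H) (A : Set G)), ?_, ?_⟩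
  · rw [← hcoset]; exact card_le_card hAF
  · rw [← hcoset]; omega

theorem three_mul_prime_mul_card_le (p : ℕ)
    (hmin : ∀ q : ℕ, q.Prime → q ∣ Fintype.card G → q % 3 = 2 → p ≤ q)
    (A : Finset G) (hA : A + A + A ≠ univ) :
    3 * p * A.card ≤ (p + 1) * Fintype.card G := by
  obtain ⟨H, a, hAa, ha⟩ := exists_addSubgroup_three_mul_le A hA
  obtain ⟨d, hd⟩ := AddSubgroup.card_addSubgroup_dvd_card H
  rw [Nat.card_eq_fintype_card (α := G)] at hd
  have hpos : 0 < Nat.card H := Nat.card_pos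
  have had : 3 * a ≤ d + 1 := by
    refine Nat.le_of_mul_le_mul_left ?_ hpos
    rw [hd] at ha
    linarith
  rcases had.lt_or_eq with h | h
  · have h3 : 3 * a ≤ d := by omega
    calc 3 * p * A.card ≤ p * ((3 * a) * Nat.card H) := by
          nlinarith [Nat.mul_le_mul_left p hAa]
      _ ≤ p * (d * Nat.card H) := by gcongr
      _ ≤ (p + 1) * Fintype.card G := by rw [hd]; nlinarith [Nat.zero_le (Nat.card H * d)]
  · obtain ⟨q, hq, hqd, hq2⟩ := Nat.exists_prime_dvd_mod_three_eq_two (show d % 3 = 2 by omega)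
    have hpq := hmin q hq (hqd.trans (hd ▸ dvd_mul_left _ _)) hq2
    have hpd : p ≤ d := hpq.trans (Nat.le_of_dvd (by omega) hqd)
    calc 3 * p * A.card ≤ p * ((3 * a) * Nat.card H) := by
          nlinarith [Nat.mul_le_mul_left p hAa]
      _ = p * d * Nat.card H + p * Nat.card H := by rw [h]; ring
      _ ≤ p * d * Nat.card H + d * Nat.card H := by gcongr
      _ = (p + 1) * Fintype.card G := by rw [hd]; ring

theorem exists_card_eq_add_add_ne_univ (p : ℕ) (hp : p.Prime) (hpn : p ∣ Fintype.card G)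
    (hp2 : p % 3 = 2) :
    ∃ A : Finset G, A.card = (p + 1) * Fintype.card G / (3 * p) ∧ A + A + A ≠ univ := by
  have : Fact p.Prime := ⟨hp⟩
  obtain ⟨f, hf⟩ := exists_surjective_addMonoidHom_zmod p hpn
  obtain ⟨k, hk⟩ : ∃ k, p + 1 = 3 * k := ⟨(p + 1) / 3, by omega⟩
  let S : Finset (ZMod p) := univ.filter fun x => x.val < k
  have hS : S.card = k := by
    rw [← card_range k]
    refine card_bij (fun x _ => x.val) (by simp [S])
      (fun _ _ _ _ h => ZMod.val_injective p h) fun b hb => ?_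
    have hbp : b < p := by have := mem_range.1 hb; have := hp.two_le; omega
    exact ⟨b, by simpa [S, ZMod.val_cast_of_lt hbp] using hb, ZMod.val_cast_of_lt hbp⟩
  let w := (univ.filter fun g => f g = 0).card
  have hw : ∀ x, (univ.filter fun g => f g = x).card = w := fun x =>
    AddMonoidHom.card_fiber_eq_of_mem_range f (hf x) (hf 0)
  have hcount : ∀ T : Finset (ZMod p), (univ.filter fun g => f g ∈ T).card = T.card * w := by
    intro T
    rw [card_eq_sum_card_fiberwise (f := f) (t := T) (fun g hg => by simpa using hg),
      ← smul_eq_mul, ← sum_const]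
    refine sum_congr rfl fun x hx => ?_
    rw [← hw x, filter_filter]
    congr 1
    ext g
    simp only [mem_filter, mem_univ, true_and, and_iff_right_iff_imp]
    rintro rfl
    exact hx
  refine ⟨univ.filter fun g => f g ∈ S, ?_, fun huniv => ?_⟩
  · have hn : Fintype.card G = p * w := by simpa [ZMod.card] using hcount univ
    rw [hcount, hS, hn, hk, show 3 * k * (p * w) = 3 * p * (k * w) by ring]
    exact (Nat.mul_div_cancel_left _ (by have := hp.pos; omega)).symm
  · obtain ⟨g, hg⟩ := hf ((p - 1 : ℕ) : ZMod p)
    have hgm := mem_univ g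
    rw [← huniv] at hgm
    obtain ⟨s, hs, z, hz, rfl⟩ := mem_add.1 hgm
    obtain ⟨x, hx, y, hy, rfl⟩ := mem_add.1 hs
    simp only [S, mem_filter, mem_univ, true_and] at hx hy hz
    have hcast : (((f x).val + (f y).val + (f z).val : ℕ) : ZMod p) = ((p - 1 : ℕ) : ZMod p) := by
      rw [← hg]
      simp
    have := hp.two_le
    have hval := congrArg ZMod.val hcast
    rw [ZMod.val_cast_of_lt (by omega), ZMod.val_cast_of_lt (by omega)] at hval
    omega

end Sumset

theorem stmt_13 {G : Type*} [AddCommGroup G] [Fintype G] [DecidableEq G]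
    (p : ℕ) (hp : p.Prime) (hpn : p ∣ Fintype.card G) (hp2 : p % 3 = 2)
    (hmin : ∀ q : ℕ, q.Prime → q ∣ Fintype.card G → q % 3 = 2 → p ≤ q) :
    IsLeast {m : ℕ | 0 < m ∧ ∀ A : Finset G, m ≤ A.card → A + A + A = Finset.univ}
      ((p + 1) * Fintype.card G / (3 * p) + 1) := by
  refine ⟨⟨Nat.succ_pos _, fun A hA => ?_⟩, fun m hm => ?_⟩
  · by_contra hne
    have h := three_mul_prime_mul_card_le p hmin A hne
    have hlt : (p + 1) * Fintype.card G < A.card * (3 * p) :=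
      (Nat.div_lt_iff_lt_mul (by have := hp.pos; omega)).1 hA
    linarith
  · obtain ⟨A, hA, hne⟩ := exists_card_eq_add_add_ne_univ (G := G) p hp hpn hp2
    by_contra! hlt
    exact hne (hm.2 A (by omega))
end

section
/- Let G be a finite abelian group of order n such that n has no prime divisor congruent to 2 mod 3. Then χ(G,3) = ⌊n/3⌋ + 1. -/
open Finset Pointwise

/-- Among the nonempty sets `X` with `X + A ≠ G`, some subgroup minimises `#(X + A) - #X`. -/
theorem exists_addSubgroup_isoperimetric {G : Type*} [AddCommGroup G] [Fintype G] [DecidableEq G]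
    (A : Finset G) (hA : A ≠ univ) :
    ∃ (H : AddSubgroup G) (S : Finset G), (∀ x, x ∈ S ↔ x ∈ H) ∧ S + A ≠ univ ∧
      ∀ X : Finset G, X.Nonempty → X + A ≠ univ → #(S + A) + #X ≤ #(X + A) + #S := by
  classical
  let P : Finset (Finset G) := univ.filter fun X => X.Nonempty ∧ X + A ≠ univ
  have hP : P.Nonempty := ⟨0, by simpa [P] using hA⟩
  obtain ⟨F₀, hF₀, hmin₀⟩ := exists_min_image P (fun X => (#(X + A) : ℤ) - #X) hP
  let Q := P.filter fun X => (#(X + A) : ℤ) - #X = #(F₀ + A) - #F₀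
  obtain ⟨F, hF, hcard₀⟩ := exists_min_image Q card ⟨F₀, by simp [Q, hF₀]⟩
  obtain ⟨⟨hne, hFA⟩, hFe⟩ : (F.Nonempty ∧ F + A ≠ univ) ∧
      (#(F + A) : ℤ) - #F = #(F₀ + A) - #F₀ := by
    simpa [Q, P] using hF
  have hmin : ∀ X : Finset G, X.Nonempty → X + A ≠ univ → #(F + A) + #X ≤ #(X + A) + #F := by
    intro X h1 h2
    have := hmin₀ X (by simp [P, h1, h2])
    lia
  have hcard : ∀ X : Finset G, X.Nonempty → X + A ≠ univ →
      #(X + A) + #F ≤ #(F + A) + #X → #F ≤ #X := by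
    intro X h1 h2 h3
    have := hmin X h1 h2
    exact hcard₀ X (by simp only [Q, P, mem_filter, mem_univ, true_and]; exact ⟨⟨h1, h2⟩, by lia⟩)
  have hdual : #F + #(F + A) ≤ Fintype.card G := by
    have hD : #(-(F + A)ᶜ) = Fintype.card G - #(F + A) := by
      rw [card_neg, card_compl]
    have hsub : -(F + A)ᶜ + A ⊆ (-F)ᶜ := by
      intro z hz
      obtain ⟨y, hy, a, ha, rfl⟩ := mem_add.1 hz
      rw [mem_compl, mem_neg']
      intro h
      rw [mem_neg', mem_compl] at hy
      exact hy (mem_add.2 ⟨_, h, a, ha, by abel⟩)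
    have hDA : #(-(F + A)ᶜ + A) ≤ Fintype.card G - #F := by
      simpa [card_compl] using card_le_card hsub
    have h1 : #(F + A) < Fintype.card G := (card_lt_iff_ne_univ _).2 hFA
    have h2 := hne.card_pos
    have h3 : #F ≤ Fintype.card G := card_le_univ _
    have := hcard (-(F + A)ᶜ) (card_pos.1 (by lia)) ((card_lt_iff_ne_univ _).1 (by lia)) (by lia)
    lia
  have htrans : ∀ v : G, (F ∩ (v +ᵥ F)).Nonempty → v +ᵥ F = F := by
    intro v hI
    by_contra hv
    have hvA : (v +ᵥ F) + A = v +ᵥ (F + A) := vadd_add_assoc _ _ _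
    have hU : (F ∪ (v +ᵥ F)) + A = (F + A) ∪ (v +ᵥ (F + A)) := by rw [union_add, hvA]
    have hIA : (F ∩ (v +ᵥ F)) + A ⊆ (F + A) ∩ (v +ᵥ (F + A)) := by
      rw [← hvA]; exact inter_add_subset
    have h1 := card_le_card hIA
    have h2 := card_inter_add_card_union (F + A) (v +ᵥ (F + A))
    have h3 := card_inter_add_card_union F (v +ᵥ F)
    rw [card_vadd_finset] at h2 h3
    have hIF : #(F ∩ (v +ᵥ F)) < #F := by
      refine card_lt_card (inter_subset_left.ssubset_of_ne fun h => hv ?_)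
      exact (eq_of_subset_of_card_le (inter_eq_left.1 h) (by simp)).symm
    have hIne : (F ∩ (v +ᵥ F)) + A ≠ univ := fun h =>
      hFA (univ_subset_iff.1 (h ▸ hIA.trans inter_subset_left))
    have h4 : ¬ _ := fun h => (hcard _ hI hIne h).not_gt hIF
    rw [← hU] at h2
    have h5 := hI.card_pos
    have := hmin (F ∪ (v +ᵥ F)) (hne.mono subset_union_left)
      ((card_lt_iff_ne_univ _).1 (by lia))
    lia
  obtain ⟨f, hf⟩ := hne
  have hS : ∀ x, x ∈ -f +ᵥ F ↔ x ∈ AddAction.stabilizer G F := by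
    intro x
    rw [AddAction.mem_stabilizer_iff, ← vadd_mem_vadd_finset_iff f, vadd_vadd, add_neg_cancel,
      zero_vadd]
    constructor
    · intro h
      exact htrans x ⟨f +ᵥ x, mem_inter.2 ⟨h, mem_vadd_finset.2 ⟨f, hf, add_comm _ _⟩⟩⟩
    · intro h
      rw [← h]
      exact mem_vadd_finset.2 ⟨f, hf, add_comm _ _⟩
  have hvA : (-f +ᵥ F) + A = -f +ᵥ (F + A) := vadd_add_assoc _ _ _
  refine ⟨_, _, hS, ?_, ?_⟩
  · rw [hvA, ← card_lt_iff_ne_univ, card_vadd_finset]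
    exact (card_lt_iff_ne_univ _).2 hFA
  · rwa [hvA, card_vadd_finset, card_vadd_finset]

theorem mod_three_ne_two_of_primes {d : ℕ} (h : ∀ q : ℕ, q.Prime → q ∣ d → q % 3 ≠ 2) :
    d % 3 ≠ 2 := by
  induction d using induction_on_primes with
  | zero => simp
  | one => simp
  | prime_mul p a hp ih =>
    have h1 := h p hp (dvd_mul_right p a)
    have h2 := ih fun q hq hqa => h q hq (hqa.mul_left p)
    have h3 : p % 3 = 0 ∨ p % 3 = 1 := by lia
    have h4 : a % 3 = 0 ∨ a % 3 = 1 := by lia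
    rcases h3 with h3 | h3 <;> rcases h4 with h4 | h4 <;> simp [Nat.mul_mod, h3, h4]

/-- The union of the cosets of `H` that meet `A` has `#(A / H) * #H` elements. -/
theorem card_add_eq_card_image_mk_mul {G : Type*} [AddCommGroup G] [Fintype G] [DecidableEq G]
    (H : AddSubgroup G) [DecidableEq (G ⧸ H)] (S A : Finset G) (hS : ∀ x, x ∈ S ↔ x ∈ H) :
    #(S + A) = #(A.image (QuotientAddGroup.mk : G → G ⧸ H)) * #S := by
  have h := AddSubgroup.card_add_eq_card_addSubgroup_add_card_quotient H (A : Set G)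
  have hSH : (S : Set G) = H := Set.ext hS
  rw [← hSH, ← coe_add, ← coe_image, add_comm A S] at h
  have hSH' : Nat.card H = #S := by
    rw [Nat.card_congr (Equiv.subtypeEquivRight fun x => (hS x).symm)]
    exact Nat.card_eq_finsetCard S
  rw [hSH', Nat.card_coe_set_eq, Nat.card_coe_set_eq, Set.ncard_coe_finset,
    Set.ncard_coe_finset] at h
  rw [h, mul_comm]

/-- Sets filling more than half of two cosets of `H` have sums covering the sum of the cosets. -/
theorem exists_add_eq_of_card_lt {G : Type*} [AddCommGroup G] [Fintype G] [DecidableEq G]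
    (H : AddSubgroup G) (S A : Finset G) (hS : ∀ x, x ∈ S ↔ x ∈ H) {a b x : G}
    (hx : x - (a + b) ∈ H) (hab : #((a +ᵥ S) \ A) + #((b +ᵥ S) \ A) < #S) :
    ∃ y ∈ A, ∃ z ∈ A, y + z = x := by
  by_contra! hne
  have hsub : a +ᵥ S ⊆ ((a +ᵥ S) \ A) ∪ ((b +ᵥ S) \ A).image (x - ·) := by
    intro y hy
    by_cases hyA : y ∈ A
    · refine mem_union_right _ (mem_image.2 ⟨x - y, mem_sdiff.2 ⟨?_, fun h => ?_⟩, by abel⟩)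
      · obtain ⟨s, hs, rfl⟩ := mem_vadd_finset.1 hy
        refine mem_vadd_finset.2 ⟨x - (a + b) - s, (hS _).2 (H.sub_mem hx ((hS _).1 hs)), ?_⟩
        simp only [vadd_eq_add]; abel
      · exact hne y hyA _ h (by abel)
    · exact mem_union_left _ (mem_sdiff.2 ⟨hy, hyA⟩)
  have h1 := (card_le_card hsub).trans (card_union_le _ _)
  have h2 : #(((b +ᵥ S) \ A).image (x - ·)) ≤ _ := card_image_le
  rw [card_vadd_finset] at h1
  lia

theorem exists_add_add_eq_of_card_lt {G : Type*} [AddCommGroup G] [Fintype G]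
    (hG : ∀ d, d ∣ Fintype.card G → d % 3 ≠ 2) (A : Finset G) (hA : Fintype.card G < 3 * #A)
    (g : G) : ∃ a ∈ A, ∃ b ∈ A, ∃ c ∈ A, a + b + c = g := by
  classical
  induction hn : Fintype.card G using Nat.strong_induction_on generalizing G with
  | _ n ih =>
  subst hn
  by_contra! hne
  have hApos : 0 < #A := by lia
  obtain ⟨a₀, ha₀⟩ := card_pos.1 hApos
  have hAA : #(A + A) + #A ≤ Fintype.card G := by
    have hdisj : Disjoint (A + A) (A.image (g - ·)) := by
      rw [disjoint_left]
      rintro x hx hx'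
      obtain ⟨a, ha, b, hb, rfl⟩ := mem_add.1 hx
      obtain ⟨c, hc, h⟩ := mem_image.1 hx'
      exact hne a ha b hb c hc (by rw [← h]; abel)
    have h := card_le_univ (A + A ∪ A.image (g - ·))
    rwa [card_union_of_disjoint hdisj, card_image_of_injective _ sub_right_injective] at h
  have hAle : #A ≤ #(A + A) := card_le_card_add_left ⟨a₀, ha₀⟩
  obtain ⟨H, S, hS, hSA, hmin⟩ := exists_addSubgroup_isoperimetric A
    ((card_lt_iff_ne_univ _).1 (by lia))
  have h₁ : #(S + A) + 1 ≤ #A + #S := by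
    simpa using hmin 0 (by simp) (by simpa using (card_lt_iff_ne_univ _).1 (by lia))
  have h₂ := hmin A ⟨a₀, ha₀⟩ ((card_lt_iff_ne_univ _).1 (by lia))
  have hSH : Fintype.card H = #S := Fintype.card_of_subtype S hS
  have hcard : Fintype.card G = Fintype.card (G ⧸ H) * #S := by
    rw [← hSH, ← Nat.card_eq_fintype_card, ← Nat.card_eq_fintype_card, ← Nat.card_eq_fintype_card]
    exact H.card_eq_card_quotient_mul_card_addSubgroup
  have hk := card_add_eq_card_image_mk_mul H S A hS
  set A' := A.image (QuotientAddGroup.mk : G → G ⧸ H)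
  set k := #A'
  set m := Fintype.card (G ⧸ H)
  have hGm : ∀ d, d ∣ m → d % 3 ≠ 2 := fun d hd => hG d (hd.trans ⟨_, hcard⟩)
  have hGS : ∀ d, d ∣ Fintype.card H → d % 3 ≠ 2 := fun d hd =>
    hG d (hd.trans ⟨m, by rw [hcard, hSH, mul_comm]⟩)
  have h0S : 0 ∈ S := (hS 0).2 H.zero_mem
  have hsub : A ⊆ S + A := fun a ha => mem_add.2 ⟨0, h0S, a, ha, zero_add a⟩
  have hle := card_le_card hsub
  have hSpos : 0 < #S := card_pos.2 ⟨0, h0S⟩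
  have hk1 : m < 3 * k := by nlinarith
  have hk2 : 3 * k < m + 3 := by nlinarith
  have hm3 := hGm m dvd_rfl
  have hkm : 3 * k = m + 2 := by lia
  have hS1 : 1 < #S := by
    by_contra hS1
    have hS1 : #S = 1 := by lia
    rw [hS1] at hcard hk h₁ h₂
    lia
  have hm1 : 1 < m := by
    by_contra hm1
    have hk1 : k = 1 := by lia
    have hm1 : m = 1 := by lia
    rw [hk1, one_mul] at hk
    rw [hm1, one_mul] at hcard
    exact hSA ((card_eq_iff_eq_univ _).1 (by lia))
  obtain ⟨u, hu, v, hv, w, hw, huvw⟩ := ih m (by nlinarith) hGm A' hk1 (g : G ⧸ H) rfl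
  obtain ⟨a, ha, rfl⟩ := mem_image.1 hu
  obtain ⟨b, hb, rfl⟩ := mem_image.1 hv
  obtain ⟨c, hc, rfl⟩ := mem_image.1 hw
  have hmem : g - (a + b + c) ∈ H := by
    rw [← QuotientAddGroup.eq_zero_iff]
    rw [QuotientAddGroup.mk_sub, QuotientAddGroup.mk_add, QuotientAddGroup.mk_add, huvw, sub_self]
  have hcoset : ∀ x ∈ A, (x +ᵥ S) \ A ⊆ (S + A) \ A := by
    intro x hx
    refine sdiff_subset_sdiff (fun y hy => ?_) subset_rfl
    obtain ⟨s, hs, rfl⟩ := mem_vadd_finset.1 hy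
    exact mem_add.2 ⟨s, hs, x, hx, add_comm _ _⟩
  have hholes : #((S + A) \ A) < #S := by
    rw [card_sdiff_of_subset hsub]; lia
  have hpair : ∀ x ∈ A, ∀ y ∈ A, ∀ z ∈ A, g - (x + y + z) ∈ H → x - y ∈ H := by
    intro x hx y hy z hz hg
    by_contra hxy
    have hdisj : Disjoint ((x +ᵥ S) \ A) ((y +ᵥ S) \ A) := by
      refine Disjoint.mono sdiff_subset sdiff_subset ?_
      rw [disjoint_left]
      intro t ht ht'
      obtain ⟨s, hs, rfl⟩ := mem_vadd_finset.1 ht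
      obtain ⟨s', hs', h⟩ := mem_vadd_finset.1 ht'
      refine hxy ?_
      have : x - y = s' - s := by
        rw [sub_eq_sub_iff_add_eq_add, add_comm s' y]; exact h.symm
      rw [this]
      exact H.sub_mem ((hS _).1 hs') ((hS _).1 hs)
    have hlt : #((x +ᵥ S) \ A) + #((y +ᵥ S) \ A) < #S := by
      rw [← card_union_of_disjoint hdisj]
      exact (card_le_card (union_subset (hcoset x hx) (hcoset y hy))).trans_lt hholes
    obtain ⟨p, hp, q, hq, hpq⟩ := exists_add_eq_of_card_lt H S A hS (x := g - z)
      (by convert hg using 1; abel) hlt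
    exact hne p hp q hq z hz (by rw [hpq]; abel)
  have hab := hpair a ha b hb c hc hmem
  have hac := hpair a ha c hc b hb (by convert hmem using 2; abel)
  have hg3 : g - (a + a + a) ∈ H := by
    have : g - (a + a + a) = g - (a + b + c) - (a - b) - (a - c) := by abel
    rw [this]
    exact H.sub_mem (H.sub_mem hmem hab) hac
  let B : Finset H := univ.filter fun x => a + (x : G) ∈ A
  have hB : #B + #((a +ᵥ S) \ A) = #S := by
    have : #B = #((a +ᵥ S) ∩ A) := by
      refine card_bij (fun x _ => a + (x : G)) ?_ ?_ ?_
      · intro x hx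
        exact mem_inter.2 ⟨mem_vadd_finset.2 ⟨x, (hS _).2 x.2, rfl⟩, by simpa [B] using hx⟩
      · intro x _ y _ h
        exact Subtype.ext (add_left_cancel h)
      · intro y hy
        obtain ⟨hy, hyA⟩ := mem_inter.1 hy
        obtain ⟨s, hs, rfl⟩ := mem_vadd_finset.1 hy
        exact ⟨⟨s, (hS _).1 hs⟩, by simpa [B] using hyA, rfl⟩
    rw [this, card_inter_add_card_sdiff, card_vadd_finset]
  have hle' : #((a +ᵥ S) \ A) ≤ k * #S - #A := by
    rw [← hk, ← card_sdiff_of_subset hsub]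
    exact card_le_card (hcoset a ha)
  have hkS : 3 * (k * #S) = m * #S + 2 * #S := by rw [← mul_assoc, hkm, add_mul]
  obtain ⟨x, hx, y, hy, z, hz, hxyz⟩ := ih (Fintype.card H) (by rw [hSH]; nlinarith) hGS B
    (by lia) ⟨_, hg3⟩ rfl
  simp only [B, mem_filter, mem_univ, true_and] at hx hy hz
  have hxyz' : (x : G) + y + z = g - (a + a + a) := congrArg Subtype.val hxyz
  refine hne _ hx _ hy _ hz ?_
  rw [show a + (x : G) + (a + y) + (a + z) = (x + y + z) + (a + a + a) by abel, hxyz']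
  abel

theorem exists_surjective_linearMap_of_ne_zero {K V : Type*} [Field K] [AddCommGroup V]
    [Module K V] {v : V} (hv : v ≠ 0) : ∃ l : V →ₗ[K] K, Function.Surjective l := by
  obtain ⟨l, hl⟩ : ∃ l : Module.Dual K V, l v ≠ 0 := by
    by_contra! hl
    exact hv ((Module.forall_dual_apply_eq_zero_iff K v).1 hl)
  exact ⟨l, LinearMap.surjective fun h0 => hl (by rw [h0]; rfl)⟩

theorem exists_surjective_zmod_of_dvd_card {G : Type*} [AddCommGroup G] [Fintype G] {p : ℕ}
    [hp : Fact p.Prime] (h : p ∣ Fintype.card G) : ∃ φ : G →+ ZMod p, Function.Surjective φ := by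
  let f : G →+ G := nsmulAddMonoidHom p
  obtain ⟨x, hx⟩ := exists_prime_addOrderOf_dvd_card p h
  have hf : ¬ Function.Surjective f := by
    rw [← Finite.injective_iff_surjective]
    intro hinj
    have hx0 : x = 0 := hinj (by simp [f, ← hx, addOrderOf_nsmul_eq_zero])
    rw [hx0, addOrderOf_zero] at hx
    exact hp.out.one_lt.ne hx
  simp only [Function.Surjective, not_forall] at hf
  obtain ⟨y, hy⟩ := hf
  have hQ : ∀ q : G ⧸ f.range, p • q = 0 := by
    intro q
    obtain ⟨g, rfl⟩ := QuotientAddGroup.mk_surjective q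
    rw [← QuotientAddGroup.mk_nsmul, QuotientAddGroup.eq_zero_iff]
    exact ⟨g, rfl⟩
  let _ : Module (ZMod p) (G ⧸ f.range) := AddCommGroup.zmodModule hQ
  have hy0 : (y : G ⧸ f.range) ≠ 0 := fun h0 => hy ((QuotientAddGroup.eq_zero_iff y).1 h0)
  obtain ⟨l, hl⟩ := exists_surjective_linearMap_of_ne_zero (K := ZMod p) hy0
  exact ⟨l.toAddMonoidHom.comp (QuotientAddGroup.mk' f.range),
    hl.comp QuotientAddGroup.mk_surjective⟩

theorem card_filter_val_lt {p : ℕ} [NeZero p] {t : ℕ} (ht : t ≤ p) :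
    #(univ.filter fun c : ZMod p => c.val < t) = t := by
  rw [← card_range t]
  refine card_bij (fun c _ => c.val) (by simp) (fun a _ b _ h => ZMod.val_injective p h) ?_
  intro i hi
  rw [card_range, mem_range] at *
  have := ZMod.val_cast_of_lt (hi.trans_le ht)
  exact ⟨i, by simpa [this] using hi, this⟩

theorem exists_card_eq_add_add_ne_univ_s14 {G : Type*} [AddCommGroup G] [Fintype G] [DecidableEq G]
    (hG : ∀ d, d ∣ Fintype.card G → d % 3 ≠ 2) :
    ∃ A : Finset G, #A = Fintype.card G / 3 ∧ ∃ g, ∀ a ∈ A, ∀ b ∈ A, ∀ c ∈ A, a + b + c ≠ g := by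
  classical
  induction hn : Fintype.card G using Nat.strong_induction_on generalizing G with
  | _ n ih =>
  subst hn
  obtain h1 | h1 := eq_or_ne (Fintype.card G) 1
  · exact ⟨∅, by simp [h1], 0, by simp⟩
  obtain ⟨p, hp, hpG, hp3⟩ : ∃ p, p.Prime ∧ p ∣ Fintype.card G ∧
      (p = 3 ∨ p % 3 = 1 ∧ Fintype.card G % 3 = 1) := by
    by_cases h3 : 3 ∣ Fintype.card G
    · exact ⟨3, Nat.prime_three, h3, Or.inl rfl⟩
    · obtain ⟨p, hp, hpG⟩ := Nat.exists_prime_and_dvd h1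
      have h4 := hG p hpG
      have h5 := hG _ dvd_rfl
      have h6 : ¬ 3 ∣ p := fun h => h3 (h.trans hpG)
      exact ⟨p, hp, hpG, Or.inr ⟨by lia, by lia⟩⟩
  have : Fact p.Prime := ⟨hp⟩
  obtain ⟨φ, hφ⟩ := exists_surjective_zmod_of_dvd_card hpG
  have hfib : ∀ c : ZMod p, #(univ.filter fun x => φ x = c) = Fintype.card φ.ker := by
    intro c
    rw [AddMonoidHom.card_fiber_eq_of_mem_range φ (hφ c) (hφ 0)]
    exact (Fintype.card_of_subtype _ (by simp [AddMonoidHom.mem_ker])).symm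
  have hlow : ∀ t ≤ p, #(univ.filter fun x => (φ x).val < t) = t * Fintype.card φ.ker := by
    intro t ht
    rw [card_eq_sum_card_fiberwise (f := φ) (t := univ.filter fun c : ZMod p => c.val < t)
      (by intro x; simp)]
    rw [sum_congr rfl (g := fun _ => Fintype.card φ.ker), sum_const, card_filter_val_lt ht,
      smul_eq_mul]
    intro c hc
    rw [← hfib c, filter_filter]
    congr 1
    ext x
    simp only [mem_filter, mem_univ, true_and] at hc ⊢
    exact ⟨fun h => h.2, fun h => ⟨h ▸ hc, h⟩⟩
  have hcard : Fintype.card G = p * Fintype.card φ.ker := by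
    rw [← hlow p le_rfl, filter_true_of_mem fun x _ => ZMod.val_lt _, card_univ]
  obtain rfl | ⟨hp1, hG1⟩ := hp3
  · refine ⟨univ.filter fun x => (φ x).val < 1, by rw [hlow 1 (by simp)]; lia, ?_⟩
    obtain ⟨g, hg⟩ := hφ 1
    refine ⟨g, fun a ha b hb c hc h => ?_⟩
    simp only [mem_filter, mem_univ, true_and, Nat.lt_one_iff, ZMod.val_eq_zero] at ha hb hc
    rw [← h, map_add, map_add, ha, hb, hc] at hg
    simp at hg
  obtain ⟨t, rfl⟩ : ∃ t, p = 3 * t + 1 := ⟨p / 3, by lia⟩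
  have ht : 0 < t := Nat.pos_of_ne_zero (by rintro rfl; exact hp.ne_one rfl)
  have hKpos : 0 < Fintype.card φ.ker := Fintype.card_pos
  obtain ⟨B, hB, k, hk⟩ := ih (Fintype.card φ.ker) (by rw [hcard]; nlinarith)
    (G := φ.ker) (fun d hd => hG d (hd.trans ⟨_, by rw [hcard, mul_comm]⟩)) rfl
  obtain ⟨g, hg⟩ := hφ (t : ZMod (3 * t + 1))
  have hgv : (φ g).val = t := by rw [hg, ZMod.val_cast_of_lt (by lia)]
  have hBg : ∀ x ∈ B.image (fun y : φ.ker => g + (y : G)), φ x = t := by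
    intro x hx
    obtain ⟨y, -, rfl⟩ := mem_image.1 hx
    rw [map_add, y.2, hg, add_zero]
  refine ⟨(univ.filter fun x => (φ x).val < t) ∪ B.image (fun y : φ.ker => g + (y : G)), ?_,
    g + g + g + k, ?_⟩
  · rw [card_union_of_disjoint, hlow t (by lia),
      card_image_of_injective _ fun x y h => Subtype.ext (add_left_cancel h), hB]
    · have : Fintype.card G = 3 * (t * Fintype.card φ.ker) + Fintype.card φ.ker := by
        rw [hcard]; ring
      lia
    · rw [disjoint_left]
      intro x hx hx'
      have h := hBg x hx'
      rw [← hg] at h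
      simp [h, hgv] at hx
  · have hle : ∀ x ∈ (univ.filter fun x => (φ x).val < t) ∪ B.image (fun y : φ.ker => g + (y : G)),
        (φ x).val ≤ t ∧ ((φ x).val = t → ∃ y ∈ B, g + (y : G) = x) := by
      intro x hx
      obtain hx | hx := mem_union.1 hx
      · have : (φ x).val < t := by simpa using hx
        exact ⟨this.le, fun h => absurd h this.ne⟩
      · exact ⟨by rw [hBg x hx, ← hg, hgv], fun _ => by simpa using mem_image.1 hx⟩
    intro a ha b hb c hc habc
    obtain ⟨ha1, ha2⟩ := hle a ha
    obtain ⟨hb1, hb2⟩ := hle b hb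
    obtain ⟨hc1, hc2⟩ := hle c hc
    have hsum : (φ a).val + (φ b).val + (φ c).val = 3 * t := by
      have h : (((φ a).val + (φ b).val + (φ c).val : ℕ) : ZMod (3 * t + 1)) = (3 * t : ℕ) := by
        have h := congrArg φ habc
        rw [map_add, map_add, map_add, map_add, map_add, k.2, hg] at h
        push_cast
        simp only [ZMod.natCast_val, ZMod.cast_id', id]
        rw [h]; ring
      rw [ZMod.natCast_eq_natCast_iff'] at h
      rwa [Nat.mod_eq_of_lt (by lia), Nat.mod_eq_of_lt (by lia)] at h
    obtain ⟨x, hx, rfl⟩ := ha2 (by lia)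
    obtain ⟨y, hy, rfl⟩ := hb2 (by lia)
    obtain ⟨z, hz, rfl⟩ := hc2 (by lia)
    refine hk x hx y hy z hz (Subtype.ext (add_left_cancel (a := g + g + g) ?_))
    rw [← habc]
    push_cast
    abel

theorem stmt_14 {G : Type*} [AddCommGroup G] [Fintype G] [DecidableEq G]
    (hnop : ∀ q : ℕ, q.Prime → q ∣ Fintype.card G → q % 3 ≠ 2) :
    IsLeast {m : ℕ | 0 < m ∧ ∀ A : Finset G, m ≤ A.card → A + A + A = Finset.univ}
      (Fintype.card G / 3 + 1) := by
  have hG : ∀ d, d ∣ Fintype.card G → d % 3 ≠ 2 := fun d hd =>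
    mod_three_ne_two_of_primes fun q hq hqd => hnop q hq (hqd.trans hd)
  refine ⟨⟨Nat.succ_pos _, fun A hA => eq_univ_of_forall fun g => ?_⟩, fun m hm => ?_⟩
  · obtain ⟨a, ha, b, hb, c, hc, h⟩ := exists_add_add_eq_of_card_lt hG A (by lia) g
    exact h ▸ add_mem_add (add_mem_add ha hb) hc
  · obtain ⟨A, hA, g, hg⟩ := exists_card_eq_add_add_ne_univ_s14 hG
    by_contra! hlt
    have h : g ∈ A + A + A := hm.2 A (by lia) ▸ mem_univ g
    obtain ⟨x, hx, c, hc, rfl⟩ := mem_add.1 h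
    obtain ⟨a, ha, b, hb, rfl⟩ := mem_add.1 hx
    exact hg a ha b hb c hc rfl
end

section
/- Let r ≥ 1, G = Z_7^r (elementary abelian 7-group) of order n = 7^r, and suppose A ⊆ G has |A| = (n−1)/3 and 0 ∉ 3A. Then |3A| = n − 3. Moreover, every such A has the structure A = {a_0, a_0'} ∪ ⋃_{k=1}^{r−1} ({a_k, 2a_k} + H_k) for some ascending chain of subgroups {0} = H_0 < H_1 < ⋯ < H_r = G with |H_k| = 7^k, a_0, a_0' ∈ H_1, and a_k ∈ H_{k+1} \ H_k. -/
open Finset Pointwise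

theorem fact_prime_seven : Fact (Nat.Prime 7) :=
  ⟨by norm_num⟩

section

attribute [local instance] fact_prime_seven

theorem sum_sq_le_of_le {ι : Type*} (T : Finset ι) (x : ι → ℝ) (h : ℝ) (hx0 : ∀ i ∈ T, 0 ≤ x i)
    (hxh : ∀ i ∈ T, x i ≤ h) (k : ℤ) :
    ∑ i ∈ T, x i ^ 2 ≤ k * h ^ 2 + (∑ i ∈ T, x i - k * h) ^ 2 := by
  classical
  induction T using Finset.induction_on generalizing k with
  | empty =>
    have : (0 : ℝ) ≤ k * (k + 1) := by
      have : 0 ≤ k * (k + 1) := by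
        rcases le_or_gt 0 k with hk | hk
        · positivity
        · nlinarith
      exact_mod_cast this
    simp
    nlinarith [mul_nonneg this (sq_nonneg h)]
  | insert i T hi ih =>
    rw [sum_insert hi, sum_insert hi]
    have ih := ih (fun j hj => hx0 j (mem_insert_of_mem hj))
      fun j hj => hxh j (mem_insert_of_mem hj)
    have h0 := hx0 i (mem_insert_self _ _)
    have h1 := hxh i (mem_insert_self _ _)
    rcases le_total 0 (∑ i ∈ T, x i - k * h) with hw | hw
    · nlinarith [ih k]
    · have := ih (k - 1)
      push_cast at this
      nlinarith

theorem sum_zmod_seven {M : Type*} [AddCommMonoid M] (x : ZMod 7 → M) :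
    ∑ i, x i = x 0 + x 1 + x 2 + x 3 + x 4 + x 5 + x 6 :=
  Fin.sum_univ_seven x

theorem sum_sq_le_of_three_small {a b c d y : ℝ} (ha : 1 / 2 ≤ a) (hy : y ≤ 1 / 2)
    (hb : 0 ≤ b) (hb' : a + b ≤ 1) (hc : 0 ≤ c) (hc' : a + c ≤ 1) (hd : 0 ≤ d) (hd' : a + d ≤ 1) :
    a ^ 2 + b ^ 2 + c ^ 2 + d ^ 2 + y ^ 2 ≤ 1 + (a + b + c + d + y - 2) ^ 2 := by
  have key := sum_sq_le_of_le univ ![b, c, d] (1 - a)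
    (by intro i; fin_cases i <;> simp <;> linarith)
    (by intro i; fin_cases i <;> simp <;> linarith) 2
  simp only [Fin.sum_univ_three, Matrix.cons_val] at key
  push_cast at key
  have p : 0 ≤ 1 / 2 - y := by linarith
  have q : 0 ≤ a - 1 / 2 := by linarith
  have w : 0 ≤ 3 - 3 * a - b - c - d := by linarith
  nlinarith [mul_nonneg p q, mul_nonneg w p, mul_nonneg w q]

theorem sum_sq_le_of_five_small {a b c d e f : ℝ} (ha : 1 / 2 ≤ a)
    (hb : 0 ≤ b) (hb' : a + b ≤ 1) (hc : 0 ≤ c) (hc' : a + c ≤ 1) (hd : 0 ≤ d) (hd' : a + d ≤ 1)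
    (he : 0 ≤ e) (he' : a + e ≤ 1) (hf : 0 ≤ f) (hf' : a + f ≤ 1)
    (hs : 16 / 7 ≤ a + b + c + d + e + f) (hs' : a + b + c + d + e + f ≤ 7 / 3)
    (ha' : 4 * a ≤ 5 - (a + b + c + d + e + f)) :
    a ^ 2 + b ^ 2 + c ^ 2 + d ^ 2 + e ^ 2 + f ^ 2 ≤ 1 + (a + b + c + d + e + f - 2) ^ 2 := by
  have key := sum_sq_le_of_le univ ![b, c, d, e, f] (1 - a)
    (by intro i; fin_cases i <;> simp <;> linarith)
    (by intro i; fin_cases i <;> simp <;> linarith)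
  simp only [Fin.sum_univ_five, Matrix.cons_val] at key
  obtain ⟨s, hs0⟩ : ∃ s, s = a + b + c + d + e + f := ⟨_, rfl⟩
  rw [← hs0] at hs hs' ha' ⊢
  have hsum : b + c + d + e + f = s - a := by linarith
  rw [hsum] at key
  rcases le_total a (4 / 7) with h | h
  · have := key 3
    push_cast at this
    nlinarith [mul_nonneg (sub_nonneg.2 ha) (sub_nonneg.2 h),
      mul_nonneg (sub_nonneg.2 ha) (sub_nonneg.2 hs')]
  · have := key 4
    push_cast at this
    nlinarith [mul_nonneg (sub_nonneg.2 h) (sub_nonneg.2 ha'),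
      mul_nonneg (sub_nonneg.2 h) (sub_nonneg.2 hs'), mul_nonneg (sub_nonneg.2 h) (sub_nonneg.2 hs)]

theorem sum_sq_le_of_half_lt (x : ZMod 7 → ℝ) (hx0 : ∀ i, 0 ≤ x i) (hx1 : ∀ i, x i ≤ 1)
    (hC : ∀ i j k, i + j + k = 0 → 0 < x k → x i + x j ≤ 1)
    (hs : 16 / 7 ≤ ∑ i, x i) (hs' : ∑ i, x i ≤ 7 / 3) (h1 : 1 / 2 < x 1) (h2 : x 2 ≤ 1 / 2)
    (h4 : x 4 ≤ 1 / 2) :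
    ∑ i, x i ^ 2 ≤ 1 + (∑ i, x i - 2) ^ 2 := by
  have hz : ∀ i j k, i + j + k = 0 → 1 < x i + x j → x k = 0 := fun i j k h hij =>
    le_antisymm (not_lt.1 fun hk => absurd (hC i j k h hk) (not_le.2 hij)) (hx0 k)
  have hp : ∀ i, x i = 0 ∨ 0 < x i := fun i => (hx0 i).eq_or_lt.imp_left Eq.symm
  simp only [sum_zmod_seven] at hs hs' ⊢
  have x5 := hz 1 1 5 (by decide) (by linarith)
  have x13 : x 1 + x 3 ≤ 1 := (hp 3).elim (fun h => by linarith [hx1 1]) (hC 1 3 3 (by decide))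
  have x0 : x 0 ≤ 1 / 2 := by
    rcases hp 0 with h | h
    · linarith
    · linarith [hC 0 0 0 (by decide) h]
  have x6 : x 6 ≤ 1 / 2 := by
    by_contra! h
    have := hz 1 6 0 (by decide) (by linarith)
    have := hz 6 6 2 (by decide) (by linarith)
    have : x 6 + x 4 ≤ 1 := (hp 4).elim (fun h => by linarith [hx1 6]) (hC 6 4 4 (by decide))
    linarith
  have pair : ∀ i j, 1 + i + j = 0 → x i = 0 ∨ x j = 0 ∨ x 1 + x i ≤ 1 ∧ x 1 + x j ≤ 1 := by
    intro i j h
    rcases hp i with hi | hi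
    · exact .inl hi
    rcases hp j with hj | hj
    · exact .inr (.inl hj)
    · exact .inr (.inr ⟨hC 1 i j h hj, hC 1 j i (by rw [← h]; ring) hi⟩)
  have p0 := hx0 0
  have p2 := hx0 2
  have p3 := hx0 3
  have p4 := hx0 4
  have p6 := hx0 6
  rw [x5] at hs hs' ⊢
  rcases pair 0 6 (by decide) with e | e | ⟨e, e'⟩ <;>
    rcases pair 2 4 (by decide) with t | t | ⟨t, t'⟩ <;> try linarith
  · have := sum_sq_le_of_three_small h1.le x6 p2 t p3 x13 p4 t'
    simp only [e]
    linarith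
  · have := sum_sq_le_of_three_small h1.le x0 p2 t p3 x13 p4 t'
    simp only [e]
    linarith
  · have := sum_sq_le_of_three_small h1.le h4 p0 e p3 x13 p6 e'
    simp only [t]
    linarith
  · have := sum_sq_le_of_three_small h1.le h2 p0 e p3 x13 p6 e'
    simp only [t]
    linarith
  · have := sum_sq_le_of_five_small h1.le p0 e p2 t p3 x13 p4 t' p6 e' (by linarith)
      (by linarith) (by linarith)
    linarith

theorem exists_half_lt_of_le_sum_sq (x : ZMod 7 → ℝ) (hx0 : ∀ i, 0 ≤ x i) (hx1 : ∀ i, x i ≤ 1)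
    (hC : ∀ i j k, i + j + k = 0 → 0 < x k → x i + x j ≤ 1)
    (hs : 16 / 7 ≤ ∑ i, x i) (hs' : ∑ i, x i ≤ 7 / 3)
    (hQ : 2 * (∑ i, x i) ^ 4 ≤ (7 * ∑ i, x i ^ 2 - (∑ i, x i) ^ 2) * (7 - ∑ i, x i) ^ 2) :
    ∃ i, i ≠ 0 ∧ 1 / 2 < x i ∧ 1 / 2 < x (2 * i) := by
  have hQ' : 1 + (∑ i, x i - 2) ^ 2 < ∑ i, x i ^ 2 := by
    generalize ∑ i, x i = s at *
    generalize ∑ i, x i ^ 2 = q at *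
    by_contra! h
    have h3 : 0 ≤ (s - 16 / 7) * (7 / 3 - s) := mul_nonneg (by linarith) (by linarith)
    have : (6 * s ^ 2 - 28 * s + 35) * (7 - s) ^ 2 < 2 * s ^ 4 := by
      nlinarith [mul_nonneg h3 (sub_nonneg.2 hs), mul_nonneg h3 h3]
    nlinarith [mul_nonneg (sub_nonneg.2 h) (sq_nonneg (7 - s))]
  by_contra! h
  obtain ⟨i, hi⟩ : ∃ i, 1 / 2 < x i := by
    by_contra! hle
    have := sum_sq_le_of_le univ x (1 / 2) (fun i _ => hx0 i) (fun i _ => hle i) 4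
    push_cast at this
    linarith
  have hi0 : i ≠ 0 := by
    rintro rfl
    linarith [hC 0 0 0 (by decide) (by linarith)]
  have hsum : ∀ g : ZMod 7 → ℝ, ∑ j, g (i * j) = ∑ j, g j := fun g =>
    Equiv.sum_comp (Equiv.mulLeft₀ i hi0) g
  have := sum_sq_le_of_half_lt (fun j => x (i * j)) (fun j => hx0 _) (fun j => hx1 _)
    (fun j k l hj => hC _ _ _ (by rw [← mul_add, ← mul_add, hj, mul_zero]))
    (by rwa [hsum]) (by rwa [hsum]) (by simpa using hi)
    (by simpa [mul_comm] using h i hi0 hi)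
    (by
      by_contra! h4
      refine absurd (h (i * 4) (mul_ne_zero hi0 (by decide)) h4) (not_le.2 ?_)
      rwa [show 2 * (i * 4) = i by
        rw [show 2 * (i * 4) = i * 8 by ring, show (8 : ZMod 7) = 1 by decide, mul_one]])
  rw [hsum, hsum fun j => x j ^ 2] at this
  linarith

section Fourier

open Module ComplexConjugate

variable {V : Type*} [AddCommGroup V] [Module (ZMod 7) V]

/-- The Fourier coefficient of a finite set at a linear functional. -/
noncomputable def fourierSum (A : Finset V) (f : Dual (ZMod 7) V) : ℂ :=
  ∑ x ∈ A, ZMod.stdAddChar (f x)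

theorem fourierSum_zero (A : Finset V) : fourierSum A 0 = A.card := by
  simp [fourierSum]

theorem ofReal_norm_fourierSum_sq (A : Finset V) (f : Dual (ZMod 7) V) :
    ((‖fourierSum A f‖ ^ 2 : ℝ) : ℂ) = ∑ x ∈ A, ∑ y ∈ A, ZMod.stdAddChar (f (x - y)) := by
  push_cast
  rw [← Complex.mul_conj', fourierSum, map_sum, sum_mul_sum]
  refine sum_congr rfl fun x _ => sum_congr rfl fun y _ => ?_
  rw [← AddChar.map_neg_eq_conj, ← AddChar.map_add_eq_mul, map_sub, sub_eq_add_neg]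

theorem norm_fourierSum_neg (A : Finset V) (f : Dual (ZMod 7) V) :
    ‖fourierSum A (-f)‖ = ‖fourierSum A f‖ := by
  rw [← Complex.norm_conj (fourierSum A f), fourierSum, fourierSum, map_sum]
  simp [AddChar.map_neg_eq_conj]

theorem sum_norm_fourierSum_smul_sq (A : Finset V) (f : Dual (ZMod 7) V) :
    ∑ t : ZMod 7, ‖fourierSum A (t • f)‖ ^ 2 =
      7 * ∑ i : ZMod 7, ((A.filter fun x => f x = i).card : ℝ) ^ 2 := by
  rw [← Complex.ofReal_inj, Complex.ofReal_sum]
  simp only [ofReal_norm_fourierSum_sq, LinearMap.smul_apply, smul_eq_mul]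
  rw [sum_comm]
  simp_rw [sum_comm (s := (univ : Finset (ZMod 7)))]
  have : ∀ x ∈ A, ∑ y ∈ A, ∑ t : ZMod 7, (ZMod.stdAddChar (t * f (x - y)) : ℂ) =
      7 * (A.filter fun y => f y = f x).card := by
    intro x _
    simp_rw [AddChar.sum_mulShift _ (ZMod.isPrimitive_stdAddChar 7), map_sub, sub_eq_zero,
      ZMod.card, eq_comm (a := f x)]
    push_cast
    rw [← sum_filter, sum_const, nsmul_eq_mul, mul_comm]
  rw [sum_congr rfl this, ← sum_fiberwise A f]
  push_cast
  rw [mul_sum]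
  refine sum_congr rfl fun i _ => ?_
  rw [sum_congr rfl fun x hx => by rw [(mem_filter.1 hx).2], sum_const, nsmul_eq_mul]
  ring

theorem two_mul_norm_fourierSum_sq_le (A : Finset V) (f : Dual (ZMod 7) V) :
    2 * ‖fourierSum A f‖ ^ 2 ≤
      7 * ∑ i : ZMod 7, ((A.filter fun x => f x = i).card : ℝ) ^ 2 - (A.card : ℝ) ^ 2 := by
  have h6 : (6 : ZMod 7) • f = -f := by
    rw [← neg_one_smul (ZMod 7) f]
    rfl
  rw [← sum_norm_fourierSum_smul_sq, sum_zmod_seven, h6, zero_smul, one_smul, norm_fourierSum_neg,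
    fourierSum_zero, Complex.norm_natCast]
  nlinarith [sq_nonneg ‖fourierSum A ((2 : ZMod 7) • f)‖,
    sq_nonneg ‖fourierSum A ((3 : ZMod 7) • f)‖,
    sq_nonneg ‖fourierSum A ((4 : ZMod 7) • f)‖, sq_nonneg ‖fourierSum A ((5 : ZMod 7) • f)‖]

variable [Finite V]

theorem sum_dual_stdAddChar [Fintype (Dual (ZMod 7) V)] [DecidableEq V] (x : V) :
    ∑ f : Dual (ZMod 7) V, (ZMod.stdAddChar (f x) : ℂ) = if x = 0 then (Nat.card V : ℂ) else 0 := by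
  classical
  have := AddChar.sum_eq_ite
    ((ZMod.stdAddChar (N := 7)).compAddMonoidHom (Dual.eval (ZMod 7) V x).toAddMonoidHom)
  refine this.trans ?_
  have hcard : Nat.card V = Fintype.card (Dual (ZMod 7) V) := by
    rw [← Nat.card_eq_fintype_card, natCard_eq_pow_finrank (K := ZMod 7),
      natCard_eq_pow_finrank (K := ZMod 7) (V := Dual (ZMod 7) V), Subspace.dual_finrank_eq]
  rw [hcard]
  refine if_congr ?_ rfl rfl
  rw [← forall_dual_apply_eq_zero_iff (ZMod 7) x, AddChar.ext_iff]
  refine forall_congr' fun f => ?_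
  rw [← ZMod.injective_stdAddChar.eq_iff (a := f x)]
  simp

theorem sum_norm_fourierSum_sq [Fintype (Dual (ZMod 7) V)] (A : Finset V) :
    ∑ f : Dual (ZMod 7) V, ‖fourierSum A f‖ ^ 2 = Nat.card V * A.card := by
  classical
  rw [← Complex.ofReal_inj, Complex.ofReal_sum]
  simp only [ofReal_norm_fourierSum_sq]
  rw [sum_comm]
  simp_rw [sum_comm (s := (univ : Finset (Dual (ZMod 7) V))), sum_dual_stdAddChar, sub_eq_zero]
  simp +contextual [mul_comm]

theorem sum_fourierSum_cube [Fintype (Dual (ZMod 7) V)] (A : Finset V)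
    (hA : ∀ x ∈ A, ∀ y ∈ A, ∀ z ∈ A, x + y + z ≠ 0) :
    ∑ f : Dual (ZMod 7) V, fourierSum A f ^ 3 = 0 := by
  classical
  have : ∀ f : Dual (ZMod 7) V, fourierSum A f ^ 3 =
      ∑ x ∈ A, ∑ y ∈ A, ∑ z ∈ A, (ZMod.stdAddChar (f (x + y + z)) : ℂ) := by
    intro f
    simp_rw [map_add, AddChar.map_add_eq_mul, ← mul_sum, ← sum_mul, ← mul_sum, ← sum_mul]
    rw [fourierSum]
    ring
  simp_rw [this]
  rw [sum_comm]
  simp_rw [sum_comm (s := (univ : Finset (Dual (ZMod 7) V))), sum_dual_stdAddChar]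
  exact sum_eq_zero fun x hx => sum_eq_zero fun y hy => sum_eq_zero fun z hz =>
    if_neg (hA x hx y hy z hz)

theorem exists_dual_large_fourierSum [Nontrivial V] (A : Finset V)
    (hA : ∀ x ∈ A, ∀ y ∈ A, ∀ z ∈ A, x + y + z ≠ 0) :
    ∃ f : Dual (ZMod 7) V, f ≠ 0 ∧
      (A.card : ℝ) ^ 2 ≤ ‖fourierSum A f‖ * (Nat.card V - A.card) := by
  classical
  have : Finite (Dual (ZMod 7) V) := finite_of_finite (ZMod 7)
  have := Fintype.ofFinite (Dual (ZMod 7) V)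
  obtain ⟨g, hg⟩ := exists_ne (0 : Dual (ZMod 7) V)
  obtain ⟨f, hf, hmax⟩ := exists_max_image (univ.erase (0 : Dual (ZMod 7) V))
    (fun f => ‖fourierSum A f‖) ⟨g, by simpa⟩
  refine ⟨f, ne_of_mem_erase hf, ?_⟩
  have h3 := sum_fourierSum_cube A hA
  have h2 := sum_norm_fourierSum_sq A
  rw [← add_sum_erase _ _ (mem_univ 0), fourierSum_zero] at h2 h3
  rw [Complex.norm_natCast] at h2
  have key : (A.card : ℝ) ^ 3 ≤ ‖fourierSum A f‖ * (Nat.card V * A.card - A.card ^ 2) := by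
    calc (A.card : ℝ) ^ 3 = ‖∑ f ∈ univ.erase (0 : Dual (ZMod 7) V), fourierSum A f ^ 3‖ := by
          rw [eq_neg_of_add_eq_zero_right h3]
          simp
      _ ≤ ∑ f ∈ univ.erase (0 : Dual (ZMod 7) V), ‖fourierSum A f ^ 3‖ := norm_sum_le _ _
      _ ≤ ∑ g ∈ univ.erase (0 : Dual (ZMod 7) V), ‖fourierSum A f‖ * ‖fourierSum A g‖ ^ 2 := by
          refine sum_le_sum fun g hg => ?_
          rw [norm_pow, pow_succ']
          exact mul_le_mul_of_nonneg_right (hmax g hg) (by positivity)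
      _ = _ := by
          rw [← mul_sum, ← h2]
          ring
  rcases A.eq_empty_or_nonempty with rfl | hne
  · simp
  have hpos : (0 : ℝ) < A.card := by exact_mod_cast hne.card_pos
  refine le_of_mul_le_mul_right ?_ hpos
  linarith

end Fourier

section Structure

open Module

variable {V : Type*} [AddCommGroup V] [Module (ZMod 7) V]

theorem seven_mul_card_fiber [Fintype V] {f : Dual (ZMod 7) V} (hf : f ≠ 0) (i : ZMod 7) :
    7 * #{x | f x = i} = Fintype.card V := by
  classical
  have hfib : ∀ j, #{x | f x = j} = #{x | f x = i} := by
    intro j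
    obtain ⟨a, ha⟩ := LinearMap.surjective hf (i - j)
    refine card_equiv (Equiv.addRight a) fun x => ?_
    simp only [mem_filter, mem_univ, true_and, Equiv.coe_addRight, map_add, ha]
    constructor
    · rintro rfl
      ring
    · intro h
      linear_combination h
  have hsum : #(univ : Finset V) = _ := card_eq_sum_card_fiberwise (f := f) (t := univ) (by simp)
  rw [← card_univ, hsum, sum_congr rfl fun j _ => hfib j]
  simp [ZMod.card]

theorem seven_mul_card_ker [Finite V] {f : Dual (ZMod 7) V} (hf : f ≠ 0) :
    7 * Nat.card (LinearMap.ker f) = Nat.card V := by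
  classical
  have := Fintype.ofFinite V
  rw [Nat.card_eq_fintype_card, Nat.card_eq_fintype_card, ← seven_mul_card_fiber hf 0,
    Fintype.card_subtype]
  simp

theorem seven_mul_card_fiber_add_le [Fintype V] {f : Dual (ZMod 7) V} (hf : f ≠ 0) {A : Finset V}
    (hA : ∀ x ∈ A, ∀ y ∈ A, ∀ z ∈ A, x + y + z ≠ 0) {i j k : ZMod 7} (hijk : i + j + k = 0)
    (hk : 0 < #{x ∈ A | f x = k}) :
    7 * (#{x ∈ A | f x = i} + #{x ∈ A | f x = j}) ≤ Fintype.card V := by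
  classical
  obtain ⟨z, hz⟩ := card_pos.1 hk
  obtain ⟨hzA, hfz⟩ := mem_filter.1 hz
  rw [← seven_mul_card_fiber hf i,
    ← card_image_of_injective {x ∈ A | f x = j} (sub_right_injective (b := -z)),
    ← card_union_of_disjoint]
  · refine Nat.mul_le_mul_left _ (card_le_card ?_)
    intro x hx
    simp only [mem_union, mem_image, mem_filter] at hx
    simp only [mem_filter, mem_univ, true_and]
    obtain ⟨-, hx⟩ | ⟨y, ⟨-, hy⟩, rfl⟩ := hx
    · exact hx
    · rw [map_sub, map_neg, hfz, hy]
      linear_combination -hijk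
  · refine disjoint_left.2 fun x hx hx' => ?_
    obtain ⟨y, hy, rfl⟩ := mem_image.1 hx'
    refine hA _ (mem_filter.1 hx).1 y (mem_filter.1 hy).1 z hzA ?_
    abel

theorem exists_dual_two_dense_fibers [Fintype V] {A : Finset V}
    (hA : ∀ x ∈ A, ∀ y ∈ A, ∀ z ∈ A, x + y + z ≠ 0) (hcard : 3 * #A + 1 = Fintype.card V)
    (hV : 49 ≤ Fintype.card V) :
    ∃ f : Dual (ZMod 7) V, f ≠ 0 ∧ Fintype.card V < 14 * #{x ∈ A | f x = 1} ∧
      Fintype.card V < 14 * #{x ∈ A | f x = 2} := by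
  classical
  have : Nontrivial V := Fintype.one_lt_card_iff_nontrivial.1 (by omega)
  obtain ⟨f, hf, hfA⟩ := exists_dual_large_fourierSum A hA
  have hQ := two_mul_norm_fourierSum_sq_le A f
  have hcardR : (3 * #A + 1 : ℝ) = Nat.card V := by
    rw [Nat.card_eq_fintype_card]
    exact_mod_cast hcard
  have hVR : (49 : ℝ) ≤ Nat.card V := by
    rw [Nat.card_eq_fintype_card]
    exact_mod_cast hV
  have hsumR : ∑ i, (#{x ∈ A | f x = i} : ℝ) = #A := by
    rw [card_eq_sum_card_fiberwise (f := f) (t := univ) (by simp)]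
    push_cast
    rfl
  obtain ⟨M, hM⟩ : ∃ M : ℝ, M = Nat.card V / 7 := ⟨_, rfl⟩
  have hM0 : 0 < M := by linarith
  have hsum : ∑ i, (#{x ∈ A | f x = i} : ℝ) / M = #A / M := by
    rw [← sum_div, hsumR]
  have hsumsq : ∑ i, ((#{x ∈ A | f x = i} : ℝ) / M) ^ 2 =
      (∑ i, (#{x ∈ A | f x = i} : ℝ) ^ 2) / M ^ 2 := by
    simp_rw [div_pow, sum_div]
  obtain ⟨i, hi, h1, h2⟩ := exists_half_lt_of_le_sum_sq
    (fun i => (#{x ∈ A | f x = i} : ℝ) / M) (fun i => by positivity)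
    (fun i => by
      rw [div_le_one hM0, hM, le_div_iff₀ (by norm_num), Nat.card_eq_fintype_card,
        ← seven_mul_card_fiber hf i, mul_comm]
      exact_mod_cast Nat.mul_le_mul_left _ (card_le_card (filter_subset_filter _ (subset_univ _))))
    (fun i j k h hk => by
      rw [← add_div, div_le_one hM0, hM, le_div_iff₀ (by norm_num), Nat.card_eq_fintype_card,
          mul_comm]
      have hk' := (div_pos_iff_of_pos_right hM0).1 hk
      exact_mod_cast seven_mul_card_fiber_add_le hf hA h (by exact_mod_cast hk'))
    (by
      rw [hsum, le_div_iff₀ hM0]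
      linarith)
    (by
      rw [hsum, div_le_iff₀ hM0]
      linarith)
    (by
      rw [hsum, hsumsq]
      have hQ' : 2 * (#A : ℝ) ^ 4 ≤ (7 * ∑ i, (#{x ∈ A | f x = i} : ℝ) ^ 2 - (#A : ℝ) ^ 2) *
          (7 * M - #A) ^ 2 := by
        calc 2 * (#A : ℝ) ^ 4 = 2 * ((#A : ℝ) ^ 2) ^ 2 := by ring
          _ ≤ 2 * (‖fourierSum A f‖ * (Nat.card V - #A)) ^ 2 := by gcongr
          _ = 2 * ‖fourierSum A f‖ ^ 2 * (Nat.card V - #A) ^ 2 := by ring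
          _ ≤ _ := by
            rw [show 7 * M = Nat.card V by rw [hM]; ring]
            exact mul_le_mul_of_nonneg_right hQ (sq_nonneg _)
      have h4 := div_le_div_of_nonneg_right hQ' (by positivity : 0 ≤ M ^ 4)
      refine le_of_eq_of_le ?_ (h4.trans_eq ?_)
      · ring
      · field_simp)
  have hlt : ∀ j, 1 / 2 < (#{x ∈ A | f x = j} : ℝ) / M →
      Fintype.card V < 14 * #{x ∈ A | f x = j} := by
    intro j hj
    rw [lt_div_iff₀ hM0, hM, Nat.card_eq_fintype_card] at hj
    have : (Fintype.card V : ℝ) < 14 * #{x ∈ A | f x = j} := by linarith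
    exact_mod_cast this
  have hfib : ∀ j, {x ∈ A | (i⁻¹ • f) x = j} = {x ∈ A | f x = j * i} := by
    intro j
    refine filter_congr fun x _ => ?_
    rw [LinearMap.smul_apply, smul_eq_mul, inv_mul_eq_iff_eq_mul₀ hi, mul_comm i]
  refine ⟨i⁻¹ • f, smul_ne_zero (inv_ne_zero hi) hf, ?_, ?_⟩
  · rw [hfib, one_mul]
    exact hlt _ h1
  · rw [hfib]
    exact hlt _ h2

theorem mem_iff_of_two_dense_fibers [Fintype V] {A : Finset V}
    (hA : ∀ x ∈ A, ∀ y ∈ A, ∀ z ∈ A, x + y + z ≠ 0) (hcard : Fintype.card V ≤ 3 * #A + 1)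
    {f : Dual (ZMod 7) V} (hf : f ≠ 0) (h1 : Fintype.card V < 14 * #{x ∈ A | f x = 1})
    (h2 : Fintype.card V < 14 * #{x ∈ A | f x = 2})
    (h0 : 7 * (3 * #{x ∈ A | f x = 0} + 1) ≤ Fintype.card V) :
    3 * #A + 1 = Fintype.card V ∧ 7 * (3 * #{x ∈ A | f x = 0} + 1) = Fintype.card V ∧
      ∀ x, f x ≠ 0 → (x ∈ A ↔ f x = 1 ∨ f x = 2) := by
  classical
  have hz : ∀ i j k, i + j + k = 0 →
      Fintype.card V < 7 * (#{x ∈ A | f x = i} + #{x ∈ A | f x = j}) →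
      #{x ∈ A | f x = k} = 0 := fun i j k h hij =>
    Nat.eq_zero_of_not_pos fun hk => absurd (seven_mul_card_fiber_add_le hf hA h hk) (not_le.2 hij)
  have h3 := hz 2 2 3 (by decide) (by omega)
  have h4 := hz 1 2 4 (by decide) (by omega)
  have h5 := hz 1 1 5 (by decide) (by omega)
  have hle : ∀ i, 7 * #{x ∈ A | f x = i} ≤ Fintype.card V := fun i => by
    rw [← seven_mul_card_fiber hf i]
    exact Nat.mul_le_mul_left _ (card_le_card (filter_subset_filter _ (subset_univ _)))
  have hsum : #A = _ := card_eq_sum_card_fiberwise (f := f) (t := univ) (by simp)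
  rw [sum_zmod_seven] at hsum
  have hle1 := hle 1
  have hle2 := hle 2
  have h6 : #{x ∈ A | f x = 6} = 0 := by
    by_contra h
    have h26 := seven_mul_card_fiber_add_le hf hA (show (2 : ZMod 7) + 6 + 6 = 0 by decide)
      (Nat.pos_of_ne_zero h)
    have h10 := seven_mul_card_fiber_add_le hf hA (show (1 : ZMod 7) + 0 + 6 = 0 by decide)
      (Nat.pos_of_ne_zero h)
    omega
  have full : ∀ i, 7 * #{x ∈ A | f x = i} = Fintype.card V → ∀ x, f x = i → x ∈ A := by
    intro i hi x hx
    have := eq_of_subset_of_card_le (filter_subset_filter (fun x => f x = i) (subset_univ A))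
      (by have := seven_mul_card_fiber hf i; omega)
    have hx' : x ∈ ({x | f x = i} : Finset V) := by simpa
    exact (mem_filter.1 (this ▸ hx')).1
  have emp : ∀ i, #{x ∈ A | f x = i} = 0 → ∀ x ∈ A, f x ≠ i := fun i hi =>
    filter_eq_empty_iff.1 (card_eq_zero.1 hi)
  refine ⟨by omega, by omega, fun x hx => ⟨fun hxA => ?_, ?_⟩⟩
  · have e3 := emp 3 h3 x hxA
    have e4 := emp 4 h4 x hxA
    have e5 := emp 5 h5 x hxA
    have e6 := emp 6 h6 x hxA
    generalize f x = t at *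
    clear * - hx e3 e4 e5 e6
    decide +revert
  · rintro (h | h)
    · exact full 1 (by omega) x h
    · exact full 2 (by omega) x h

theorem exists_three_mul_add_one_eq_seven_pow (r : ℕ) : ∃ m, 3 * m + 1 = 7 ^ r := by
  induction r with
  | zero => exact ⟨0, rfl⟩
  | succ r ih =>
    obtain ⟨m, hm⟩ := ih
    exact ⟨7 * m + 2, by rw [pow_succ, ← hm]; ring⟩

set_option maxRecDepth 100000 in
theorem card_le_two_of_add_add_ne_zero :
    ∀ A : Finset (ZMod 7), (∀ x ∈ A, ∀ y ∈ A, ∀ z ∈ A, x + y + z ≠ 0) → #A ≤ 2 := by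
  decide

theorem card_add_add_pair : ∀ a b : ZMod 7, a ≠ b →
    (0 : ZMod 7) ∉ ({a, b} + {a, b} + {a, b} : Finset (ZMod 7)) →
    #({a, b} + {a, b} + {a, b} : Finset (ZMod 7)) = 4 := by
  decide

theorem exists_linearEquiv_zmod_seven [Finite V] (hV : Nat.card V = 7) :
    Nonempty (V ≃ₗ[ZMod 7] ZMod 7) := by
  have : Nontrivial V := Finite.one_lt_card_iff_nontrivial.1 (by omega)
  obtain ⟨f, hf⟩ := exists_ne (0 : Dual (ZMod 7) V)
  refine ⟨LinearEquiv.ofBijective f ?_⟩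
  refine (Nat.bijective_iff_surjective_and_card _).2 ⟨LinearMap.surjective hf, ?_⟩
  rw [hV, Nat.card_zmod]

theorem card_subtype_ker (A : Finset V) (f : Dual (ZMod 7) V)
    [DecidablePred (· ∈ LinearMap.ker f)] :
    #(A.subtype (· ∈ LinearMap.ker f)) = #{x ∈ A | f x = 0} := by
  rw [card_subtype]
  simp [LinearMap.mem_ker]

end Structure

section Induction

universe u

open Module

theorem three_mul_card_add_one_le (r : ℕ) : ∀ (V : Type u) [AddCommGroup V] [Module (ZMod 7) V]
    [Finite V] (A : Finset V), Nat.card V = 7 ^ r →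
    (∀ x ∈ A, ∀ y ∈ A, ∀ z ∈ A, x + y + z ≠ 0) → 3 * #A + 1 ≤ 7 ^ r := by
  induction r with
  | zero =>
    intro V _ _ _ A hV hA
    have : Subsingleton V := (Nat.card_eq_one_iff_unique.1 hV).1
    have : A = ∅ := eq_empty_of_forall_notMem fun x hx => hA x hx x hx x hx (Subsingleton.elim _ _)
    simp [this]
  | succ r ih =>
    intro V _ _ _ A hV hA
    classical
    have := Fintype.ofFinite V
    rcases Nat.eq_zero_or_pos r with rfl | hr
    · obtain ⟨e⟩ := exists_linearEquiv_zmod_seven hV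
      have := card_le_two_of_add_add_ne_zero (A.image e) (by
        simp only [mem_image, forall_exists_index, and_imp, forall_apply_eq_imp_iff₂, ← map_add]
        intro x hx y hy z hz
        rw [Ne, e.map_eq_zero_iff]
        exact hA x hx y hy z hz)
      rw [card_image_of_injective _ e.injective] at this
      omega
    · have hV' : Fintype.card V = 7 ^ (r + 1) := by rw [← hV, Nat.card_eq_fintype_card]
      have h49 : 7 ^ 2 ≤ 7 ^ (r + 1) := Nat.pow_le_pow_right (by norm_num) (by omega)
      by_contra! hlt
      obtain ⟨m, hm⟩ := exists_three_mul_add_one_eq_seven_pow (r + 1)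
      obtain ⟨B, hBA, hB⟩ := exists_subset_card_eq (s := A) (n := m) (by omega)
      obtain ⟨f, hf, h1, h2⟩ := exists_dual_two_dense_fibers (A := B)
        (fun x hx y hy z hz => hA x (hBA hx) y (hBA hy) z (hBA hz)) (by omega) (by omega)
      have hmono : ∀ i, #{x ∈ B | f x = i} ≤ #{x ∈ A | f x = i} := fun i =>
        card_le_card (filter_subset_filter _ hBA)
      have hk := seven_mul_card_ker hf
      have h0 := ih (LinearMap.ker f) (A.subtype (· ∈ LinearMap.ker f)) (by
        rw [pow_succ] at hV
        omega) (by
        simp only [mem_subtype]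
        intro x hx y hy z hz h
        exact hA _ hx _ hy _ hz (congrArg Subtype.val h))
      rw [card_subtype_ker] at h0
      have := mem_iff_of_two_dense_fibers hA (by omega) hf
        (h1.trans_le (Nat.mul_le_mul_left _ (hmono 1)))
        (h2.trans_le (Nat.mul_le_mul_left _ (hmono 2))) (by rw [hV', pow_succ]; omega)
      omega

/-- The set `A` consists of two points of `H 1` and of the cosets `a k + H k`, `2 a k + H k` along
a full flag `H` of subgroups with consecutive quotients of order `7`. -/
def HasChainStructure {V : Type*} [AddCommGroup V] (r : ℕ) (A : Finset V) : Prop :=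
  ∃ (H : ℕ → AddSubgroup V) (a₀ a₀' : V) (a : ℕ → V),
    H 0 = ⊥ ∧ H r = ⊤ ∧
    (∀ k < r, H k < H (k + 1)) ∧
    (∀ k ≤ r, Nat.card (H k) = 7 ^ k) ∧
    a₀ ∈ H 1 ∧ a₀' ∈ H 1 ∧
    (∀ k, 1 ≤ k → k ≤ r - 1 → a k ∈ H (k + 1) ∧ a k ∉ H k) ∧
    (A : Set V) = {a₀, a₀'} ∪
      ⋃ k ∈ Set.Icc 1 (r - 1), (({a k, a k + a k} : Set V) + (H k : Set V))

theorem hasChainStructure_one {V : Type*} [AddCommGroup V] [DecidableEq V] (hV : Nat.card V = 7)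
    (b c : V) : HasChainStructure 1 ({b, c} : Finset V) := by
  have : Nontrivial V := by
    have : Finite V := Nat.finite_of_card_ne_zero (by omega)
    exact Finite.one_lt_card_iff_nontrivial.1 (by omega)
  refine ⟨fun k => if k = 0 then ⊥ else ⊤, b, c, 0, by simp, by simp, ?_, ?_, by simp, by simp,
    fun k h1 h2 => by omega, by simp⟩
  · intro k hk
    obtain rfl : k = 0 := by omega
    simp [bot_lt_top]
  · intro k hk
    interval_cases k <;> simp [hV]

variable {V : Type u} [AddCommGroup V] [Module (ZMod 7) V]

theorem HasChainStructure.succ {r : ℕ} (hr : 1 ≤ r) (hV : Nat.card V = 7 ^ (r + 1))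
    {A : Finset V} {f : Dual (ZMod 7) V} (hf : f ≠ 0)
    [DecidablePred (· ∈ LinearMap.ker f)]
    (hfA : ∀ x, f x ≠ 0 → (x ∈ A ↔ f x = 1 ∨ f x = 2))
    (h : HasChainStructure r (A.subtype (· ∈ LinearMap.ker f))) :
    HasChainStructure (r + 1) A := by
  obtain ⟨H, b, b', a, hbot, htop, hlt, hcard, hb, hb', ha, hA⟩ := h
  obtain ⟨c, hc⟩ := LinearMap.surjective hf 1
  let i : LinearMap.ker f →+ V := (LinearMap.ker f).subtype.toAddMonoidHom
  have hi : Function.Injective i := Subtype.val_injective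
  have hi' : ∀ x, i x = x := fun _ => rfl
  have hker : ∀ x, x ∈ (⊤ : AddSubgroup (LinearMap.ker f)).map i ↔ f x = 0 := by
    intro x
    simp [hi', LinearMap.mem_ker]
  let H' : ℕ → AddSubgroup V := fun k => if k ≤ r then (H k).map i else ⊤
  have hH' : ∀ k ≤ r, H' k = (H k).map i := fun k hk => if_pos hk
  have hH'r : H' (r + 1) = ⊤ := if_neg (by omega)
  let a' : ℕ → V := fun k => if k < r then i (a k) else c
  have ha' : ∀ k < r, a' k = i (a k) := fun k hk => if_pos hk
  have ha'r : a' r = c := if_neg (lt_irrefl r)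
  refine ⟨H', i b, i b', a', ?_, hH'r, ?_, ?_, ?_, ?_, ?_, ?_⟩
  · rw [hH' 0 (by omega), hbot, AddSubgroup.map_bot]
  · intro k hk
    rcases Nat.lt_succ_iff_lt_or_eq.1 hk with hk | rfl
    · rw [hH' k (by omega), hH' (k + 1) (by omega)]
      exact (AddSubgroup.map_lt_map_iff_of_injective hi).2 (hlt k hk)
    · rw [hH'r, hH' k le_rfl, htop, lt_top_iff_ne_top]
      intro h
      have := (hker c).1 (h ▸ AddSubgroup.mem_top c)
      rw [hc] at this
      exact absurd this (by decide)
  · intro k hk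
    rcases Nat.le_succ_iff.1 hk with hk | rfl
    · rw [hH' k hk, ← hcard k hk]
      exact (Nat.card_congr ((H k).equivMapOfInjective i hi).toEquiv).symm
    · rw [hH'r, ← hV]
      exact Nat.card_congr AddSubgroup.topEquiv.toEquiv
  · rw [hH' 1 hr]
    exact AddSubgroup.mem_map_of_mem i hb
  · rw [hH' 1 hr]
    exact AddSubgroup.mem_map_of_mem i hb'
  · intro k h1 hk
    rcases Nat.lt_or_eq_of_le (show k ≤ r by omega) with hk | rfl
    · rw [hH' k (by omega), hH' (k + 1) (by omega), ha' k hk]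
      have := ha k h1 (by omega)
      exact ⟨AddSubgroup.mem_map_of_mem i this.1,
        fun h => this.2 ((AddSubgroup.mem_map_iff_mem hi).1 h)⟩
    · rw [hH'r, hH' k le_rfl, htop, hker, ha'r, hc]
      exact ⟨AddSubgroup.mem_top c, by decide⟩
  · have hlow : ∀ k ∈ Set.Icc 1 (r - 1), ({a' k, a' k + a' k} : Set V) + (H' k : Set V) =
        i '' (({a k, a k + a k} : Set (LinearMap.ker f)) + (H k : Set (LinearMap.ker f))) := by
      intro k hk
      have : k < r := by have := hk.2; omega
      rw [Set.image_add, Set.image_pair, map_add, ha' k this, hH' k this.le, AddSubgroup.coe_map]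
    have htop' : ∀ x, x ∈ ({a' r, a' r + a' r} : Set V) + (H' r : Set V) ↔ f x = 1 ∨ f x = 2 := by
      intro x
      simp only [Set.mem_add, Set.mem_insert_iff, Set.mem_singleton_iff, exists_eq_or_imp,
        exists_eq_left, SetLike.mem_coe, hH' r le_rfl, htop, hker, ha'r]
      constructor
      · rintro (⟨y, hy, rfl⟩ | ⟨y, hy, rfl⟩) <;> simp [hy, hc, one_add_one_eq_two]
      · rintro (h | h)
        · exact .inl ⟨x - c, by simp [h, hc], by abel⟩
        · exact .inr ⟨x - (c + c), by simp [h, hc, one_add_one_eq_two], by abel⟩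
    have hIcc : Set.Icc 1 (r + 1 - 1) = insert r (Set.Icc 1 (r - 1)) := by
      ext k
      simp only [Set.mem_Icc, Set.mem_insert_iff]
      omega
    rw [hIcc, Set.biUnion_insert, Set.iUnion₂_congr hlow, ← Set.image_iUnion₂, Set.union_left_comm,
      ← Set.image_pair, ← Set.image_union, ← hA]
    ext x
    rw [Set.mem_union, htop', mem_coe]
    by_cases hx : f x = 0
    · have h12 : ¬ (f x = 1 ∨ f x = 2) := by
        rw [hx]
        decide
      rw [or_iff_right h12]
      simp [hi', hx, LinearMap.mem_ker]
    · simp [hfA x hx, hi', LinearMap.mem_ker, hx]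

theorem card_add_add_eq [Finite V] [DecidableEq V] {r : ℕ} (hV : Nat.card V = 7 ^ (r + 1))
    {A : Finset V} {f : Dual (ZMod 7) V} (hf : f ≠ 0)
    [DecidablePred (· ∈ LinearMap.ker f)]
    (hfA : ∀ x, f x ≠ 0 → (x ∈ A ↔ f x = 1 ∨ f x = 2))
    (hne : (A.subtype (· ∈ LinearMap.ker f)).Nonempty) :
    #(A + A + A) = 6 * 7 ^ r + #(A.subtype (· ∈ LinearMap.ker f) +
      A.subtype (· ∈ LinearMap.ker f) + A.subtype (· ∈ LinearMap.ker f)) := by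
  have := Fintype.ofFinite V
  have hA1 : ∀ x, f x = 1 → x ∈ A := fun x hx => (hfA x (by rw [hx]; decide)).2 (.inl hx)
  have hA2 : ∀ x, f x = 2 → x ∈ A := fun x hx => (hfA x (by rw [hx]; decide)).2 (.inr hx)
  have hfib := seven_mul_card_fiber hf 0
  rw [← Nat.card_eq_fintype_card, hV] at hfib
  obtain ⟨b, hb⟩ := LinearMap.surjective hf 1
  have hb2 : f (b + b) = 2 := by rw [map_add, hb]; rfl
  obtain ⟨⟨c, hc⟩, hcA⟩ := hne
  rw [mem_subtype] at hcA
  rw [LinearMap.mem_ker] at hc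
  have hker : (A + A + A).subtype (· ∈ LinearMap.ker f) = A.subtype (· ∈ LinearMap.ker f) +
      A.subtype (· ∈ LinearMap.ker f) + A.subtype (· ∈ LinearMap.ker f) := by
    have hval : ∀ x ∈ A, f x = 0 ∨ f x = 1 ∨ f x = 2 := fun x hx =>
      or_iff_not_imp_left.2 fun h => (hfA x h).1 hx
    ext ⟨x, hx⟩
    simp only [mem_subtype, mem_add]
    constructor
    · rintro ⟨_, ⟨y, hy, z, hz, rfl⟩, w, hw, rfl⟩
      rw [LinearMap.mem_ker, map_add, map_add] at hx
      have key : f y = 0 ∧ f z = 0 ∧ f w = 0 := by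
        have h1 := hval y hy
        have h2 := hval z hz
        have h3 := hval w hw
        generalize f y = s at *
        generalize f z = t at *
        generalize f w = u at *
        clear * - h1 h2 h3 hx
        decide +revert
      exact ⟨_, ⟨⟨y, key.1⟩, hy, ⟨z, key.2.1⟩, hz, rfl⟩, ⟨w, key.2.2⟩, hw, rfl⟩
    · rintro ⟨_, ⟨y, hy, z, hz, rfl⟩, w, hw, h⟩
      exact ⟨_, ⟨y, hy, z, hz, rfl⟩, w, hw, congrArg Subtype.val h⟩
  have hcompl : {x ∈ A + A + A | ¬ f x = 0} = ({x | ¬ f x = 0} : Finset V) := by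
    refine Subset.antisymm (filter_subset_filter _ (subset_univ _)) fun x hx => ?_
    rw [mem_filter] at hx ⊢
    refine ⟨?_, hx.2⟩
    have split : ∀ y z, y ∈ A → z ∈ A → f (x - y - z) = 1 ∨ f (x - y - z) = 2 →
        x ∈ A + A + A := by
      intro y z hy hz h
      rw [show x = x - y - z + z + y by abel]
      exact add_mem_add (add_mem_add (h.elim (hA1 _) (hA2 _)) hz) hy
    have hb' := hA1 b hb
    have hbb := hA2 _ hb2
    have cases : ∀ t : ZMod 7, ¬ t = 0 → (t - 0 - 0 = 1 ∨ t - 0 - 0 = 2) ∨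
        (t - 1 - 1 = 1 ∨ t - 1 - 1 = 2) ∨ (t - 2 - 2 = 1 ∨ t - 2 - 2 = 2) := by decide
    rcases cases (f x) hx.2 with h | h | h
    · exact split c c hcA hcA (by rwa [map_sub, map_sub, hc])
    · exact split b b hb' hb' (by rwa [map_sub, map_sub, hb])
    · exact split _ _ hbb hbb (by rwa [map_sub, map_sub, hb2])
  have h1 := card_filter_add_card_filter_not (s := (univ : Finset V)) (fun x => f x = 0)
  have h2 := card_filter_add_card_filter_not (s := A + A + A) (fun x => f x = 0)
  rw [card_univ, ← Nat.card_eq_fintype_card, hV] at h1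
  rw [hcompl, ← card_subtype_ker, hker] at h2
  rw [pow_succ] at hfib h1
  omega

theorem card_add_add_and_hasChainStructure {r : ℕ} (hr : 1 ≤ r) :
    ∀ (V : Type u) [AddCommGroup V] [Module (ZMod 7) V] [Finite V] [DecidableEq V] (A : Finset V),
      Nat.card V = 7 ^ r → 3 * #A + 1 = 7 ^ r → (∀ x ∈ A, ∀ y ∈ A, ∀ z ∈ A, x + y + z ≠ 0) →
      #(A + A + A) = 7 ^ r - 3 ∧ HasChainStructure r A := by
  induction r, hr using Nat.le_induction with
  | base =>
    intro V _ _ _ _ A hV hcard hA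
    obtain ⟨b, c, hbc, rfl⟩ := card_eq_two.1 (show #A = 2 by omega)
    refine ⟨?_, hasChainStructure_one hV b c⟩
    obtain ⟨e⟩ := exists_linearEquiv_zmod_seven hV
    have himg : ({b, c} + {b, c} + {b, c} : Finset V).image e =
        {e b, e c} + {e b, e c} + {e b, e c} := by
      rw [image_add, image_add, image_insert, image_singleton]
    rw [← card_image_of_injective _ e.injective, himg]
    refine card_add_add_pair _ _ (e.injective.ne hbc) ?_
    rw [← himg, ← map_zero e, e.injective.mem_finset_image]
    simp only [mem_add, not_exists, not_and]
    rintro _ ⟨x, hx, y, hy, rfl⟩ z hz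
    exact hA x hx y hy z hz
  | succ r hr ih =>
    intro V _ _ _ _ A hV hcard hA
    classical
    have := Fintype.ofFinite V
    have hV' : Fintype.card V = 7 ^ (r + 1) := by rw [← hV, Nat.card_eq_fintype_card]
    have h49 : 7 ^ 2 ≤ 7 ^ (r + 1) := Nat.pow_le_pow_right (by norm_num) (by omega)
    obtain ⟨f, hf, h1, h2⟩ := exists_dual_two_dense_fibers hA (by omega) (by omega)
    have hk : Nat.card (LinearMap.ker f) = 7 ^ r := by
      have := seven_mul_card_ker hf
      rw [pow_succ] at hV
      omega
    have hA₀ : ∀ x ∈ A.subtype (· ∈ LinearMap.ker f), ∀ y ∈ A.subtype (· ∈ LinearMap.ker f),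
        ∀ z ∈ A.subtype (· ∈ LinearMap.ker f), x + y + z ≠ 0 := by
      simp only [mem_subtype]
      intro x hx y hy z hz h
      exact hA _ hx _ hy _ hz (congrArg Subtype.val h)
    have h0 := three_mul_card_add_one_le r _ _ hk hA₀
    obtain ⟨-, h0', hfA⟩ := mem_iff_of_two_dense_fibers hA (by omega) hf h1 h2 (by
      rw [hV', pow_succ, ← card_subtype_ker]
      omega)
    rw [hV', pow_succ, ← card_subtype_ker] at h0'
    obtain ⟨hsum, hchain⟩ := ih _ _ hk (by omega) hA₀
    have h7 : 7 ^ 1 ≤ 7 ^ r := Nat.pow_le_pow_right (by norm_num) hr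
    refine ⟨?_, hchain.succ hr hV hf hfA⟩
    rw [card_add_add_eq hV hf hfA (card_pos.1 (by omega)), hsum, pow_succ]
    omega

end Induction

end

theorem stmt_19 (r : ℕ) (hr : 1 ≤ r)
    (A : Finset (Fin r → ZMod 7))
    (hA : 3 * A.card = 7 ^ r - 1)
    (h0 : (0 : Fin r → ZMod 7) ∉ A + A + A) :
    (A + A + A).card = 7 ^ r - 3 ∧
    ∃ (H : ℕ → AddSubgroup (Fin r → ZMod 7)) (a₀ a₀' : Fin r → ZMod 7)
      (a : ℕ → (Fin r → ZMod 7)),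
      H 0 = ⊥ ∧ H r = ⊤ ∧
      (∀ k < r, H k < H (k + 1)) ∧
      (∀ k ≤ r, Nat.card (H k) = 7 ^ k) ∧
      a₀ ∈ H 1 ∧ a₀' ∈ H 1 ∧
      (∀ k, 1 ≤ k → k ≤ r - 1 → a k ∈ H (k + 1) ∧ a k ∉ H k) ∧
      (A : Set (Fin r → ZMod 7)) =
        {a₀, a₀'} ∪
          ⋃ k ∈ Set.Icc 1 (r - 1),
            (({a k, a k + a k} : Set (Fin r → ZMod 7)) + (H k : Set (Fin r → ZMod 7))) := by
  have hpos : 0 < 7 ^ r := by positivity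
  refine card_add_add_and_hasChainStructure hr (Fin r → ZMod 7) A (by simp) (by omega)
    fun x hx y hy z hz h => h0 ?_
  rw [← h]
  exact add_mem_add (add_mem_add hx hy) hz
end
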